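/- Let k be a field of characteristic zero and G a finite subgroup of SL_d(k) acting on S = k[x_1,…,x_d] with invariant subring R = S^G, and assume R is an isolated singularity. Let X be a finitely generated R-module which is maximal Cohen–Macaulay (i.e., Ext^i_R(X, R) = 0 for all i > 0) and satisfies Ext^j_R(X, S) = 0 for all 0 < j < d − 1. Then X is isomorphic to a direct summand of a finite direct sum of copies of S as an R-module. -/

import Mathlib

open MvPolynomial Matrix

noncomputable section

variable (k : Type) [Field k] (d : ℕ)

def matAct (M : Matrix (Fin d) (Fin d) k) :
    MvPolynomial (Fin d) k →ₐ[k] MvPolynomial (Fin d) k :=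
  aeval fun i => ∑ j, M j i • X j

/-- The invariant subalgebra `R = S^G` of a subgroup `G ≤ SL_d(k)`. -/
def invRSL (G : Subgroup (Matrix.SpecialLinearGroup (Fin d) k)) :
    Subalgebra k (MvPolynomial (Fin d) k) where
  carrier := {s | ∀ g ∈ G, matAct k d (g : Matrix (Fin d) (Fin d) k) s = s}
  mul_mem' ha hb := fun g hg => by rw [_root_.map_mul, ha g hg, hb g hg]
  add_mem' ha hb := fun g hg => by rw [_root_.map_add, ha g hg, hb g hg]
  algebraMap_mem' r := fun g hg => (matAct k d _).commutes r

/-- A commutative ring is regular local if it is Noetherian local and its maximal ideal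
is generated by `dim A` elements. -/
def IsRegularLocal (A : Type) [CommRing A] : Prop :=
  IsNoetherianRing A ∧ ∃ (h : IsLocalRing A) (n : ℕ) (s : Fin n → A),
    Ideal.span (Set.range s) = @IsLocalRing.maximalIdeal A _ h ∧ ringKrullDim A = n

/-- The graded ('irrelevant') maximal ideal `m` of `R = S^G`: the contraction of the
irrelevant ideal `(x_1,…,x_d)` of `S`. -/
def irrId (G : Subgroup (Matrix.SpecialLinearGroup (Fin d) k)) : Ideal ↥(invRSL k d G) :=
  Ideal.comap (algebraMap ↥(invRSL k d G) (MvPolynomial (Fin d) k))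
    (Ideal.span (Set.range (X : Fin d → MvPolynomial (Fin d) k)))

/-- `R = S^G` is an isolated singularity: `R_p` is regular for every prime `p ≠ m`. -/
def IsIsolatedSing (G : Subgroup (Matrix.SpecialLinearGroup (Fin d) k)) : Prop :=
  ∀ (p : Ideal ↥(invRSL k d G)) (hp : p.IsPrime), p ≠ irrId k d G →
    IsRegularLocal (Localization (@Ideal.primeCompl _ _ p hp))

set_option linter.style.haveILetI false
set_option linter.unusedSimpArgs false
namespace H16
section PartA

/-- `M` is an `n`-th syzygy over `A`. -/
def IsSyz (A : Type) [CommRing A] : ℕ → ∀ (M : Type) [AddCommGroup M] [Module A M], Prop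
  | 0, _, _, _ => True
  | n + 1, M, _, _ => ∃ (P : Type) (_ : AddCommGroup P) (_ : Module A P)
      (N : Type) (_ : AddCommGroup N) (_ : Module A N) (i : M →ₗ[A] P) (q : P →ₗ[A] N),
      Module.Projective A P ∧ Function.Injective i ∧ Function.Exact i q ∧
      Function.Surjective q ∧ IsSyz A n N

/-- every `n`-th syzygy is projective -/
def GlDim (A : Type) [CommRing A] (n : ℕ) : Prop :=
  ∀ (M : Type) [AddCommGroup M] [Module A M], IsSyz A n M → Module.Projective A M

theorem projective_trans (A B P : Type) [CommRing A] [CommRing B] [Algebra A B]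
    [Module.Projective A B] [AddCommGroup P] [Module A P] [Module B P] [IsScalarTower A B P]
    [h : Module.Projective B P] : Module.Projective A P := by
  obtain ⟨s, hs⟩ := h.out
  classical
  haveI : Module.Projective A (P →₀ B) :=
    Module.Projective.of_equiv (finsuppLequivDFinsupp (ι := P) (M := B) A).symm
  exact Module.Projective.of_split (s.restrictScalars A)
    ((Finsupp.linearCombination B id : (P →₀ B) →ₗ[B] P).restrictScalars A)
    (LinearMap.ext fun x => hs x)

theorem IsSyz.restrict {A B : Type} [CommRing A] [CommRing B] [Algebra A B]
    [Module.Projective A B] (n : ℕ) :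
    ∀ (M : Type) [AddCommGroup M] [Module A M] [Module B M] [IsScalarTower A B M],
    IsSyz B n M → IsSyz A n M := by
  induction n with
  | zero => intros; trivial
  | succ n ih =>
    intro M _ _ _ _ ⟨P, _, _, N, _, _, i, q, hP, hi, hiq, hq, hN⟩
    letI : Module A P := Module.compHom P (algebraMap A B)
    letI : Module A N := Module.compHom N (algebraMap A B)
    haveI : IsScalarTower A B P := ⟨fun a b x => by
      rw [Algebra.smul_def, mul_smul]; rfl⟩
    haveI : IsScalarTower A B N := ⟨fun a b x => by
      rw [Algebra.smul_def, mul_smul]; rfl⟩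
    refine ⟨P, _, _, N, _, _, i.restrictScalars A, q.restrictScalars A,
      ?_, hi, hiq, hq, ih N hN⟩
    exact projective_trans A B P

theorem schanuel {A M P N K0 K1 : Type} [CommRing A] [AddCommGroup M] [Module A M]
    [AddCommGroup P] [Module A P] [AddCommGroup N] [Module A N] [AddCommGroup K0] [Module A K0]
    [AddCommGroup K1] [Module A K1] [Module.Projective A P] [Module.Projective A K0]
    [Module.Projective A K1] (i : M →ₗ[A] P) (q : P →ₗ[A] N) (hi : Function.Injective i)
    (hiq : Function.Exact i q) (j : K1 →ₗ[A] K0)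
    (r : K0 →ₗ[A] N) (hj : Function.Injective j) (hjr : Function.Exact j r)
    (hr : Function.Surjective r) (hq : Function.Surjective q) : Module.Projective A M := by
  obtain ⟨u, hu⟩ := Module.projective_lifting_property r q hr
  obtain ⟨v, hv⟩ := Module.projective_lifting_property q r hq
  have hu' : ∀ x, r (u x) = q x := fun x => LinearMap.congr_fun hu x
  have hv' : ∀ x, q (v x) = r x := fun x => LinearMap.congr_fun hv x
  -- M → P × K1
  have h1 : ∀ m : M, ∃ y : K1, j y = u (i m) := fun m => (hjr _).1 (by rw [hu']; exact hiq.apply_apply_eq_zero m)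
  have h2 : ∀ z : P × K1, ∃ y : M, i y = z.1 - v (u z.1) + v (j z.2) := fun z => (hiq _).1 (by
    simp [hv', hu', hjr.apply_apply_eq_zero])
  choose a ha using h1
  choose b hb using h2
  let a' : M →ₗ[A] K1 := { toFun := a, map_add' := fun x y => hj (by simp [ha]),
                           map_smul' := fun c x => hj (by simp [ha]) }
  have hb1 : ∀ x y, b (x + y) = b x + b y := fun x y => by
    apply hi
    simp only [hb, map_add, Prod.fst_add, Prod.snd_add]
    abel
  have hb2 : ∀ (c : A) x, b (c • x) = c • b x := fun c x => by
    apply hi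
    simp only [hb, map_smul, Prod.smul_fst, Prod.smul_snd, smul_sub, smul_add]
  let b' : P × K1 →ₗ[A] M := LinearMap.mk (AddHom.mk b hb1) hb2
  refine Module.Projective.of_split (i.prod a') b' ?_
  ext x
  apply hi
  change i (b _) = _
  rw [hb]
  change i x - v (u (i x)) + v (j (a x)) = _
  rw [ha]; simp

open scoped Polynomial TensorProduct in
/-- A `B[t]`-module that is `B`-projective has projective dimension at most one. -/
theorem koszul1 {B N : Type} [CommRing B] [AddCommGroup N] [Module B N] [Module B[X] N]
    [IsScalarTower B B[X] N] [Module.Projective B N] :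
    ∃ (K : Type) (_ : AddCommGroup K) (_ : Module B[X] K) (j : K →ₗ[B[X]] K) (r : K →ₗ[B[X]] N),
    Module.Projective B[X] K ∧ Function.Injective j ∧ Function.Exact j r ∧
      Function.Surjective r := by
  let t : N →ₗ[B] N := (LinearMap.lsmul B[X] N Polynomial.X).restrictScalars B
  have ht : ∀ x, t x = (Polynomial.X : B[X]) • x := fun x => rfl
  let D : TensorProduct B B[X] N →ₗ[B[X]] TensorProduct B B[X] N := LinearMap.lsmul B[X] (TensorProduct B B[X] N) Polynomial.X - LinearMap.baseChange B[X] t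
  let r : TensorProduct B B[X] N →ₗ[B[X]] N := TensorProduct.AlgebraTensorModule.lift
    (LinearMap.toSpanSingleton B[X] (N →ₗ[B] N) LinearMap.id)
  have hr : ∀ p x, r (p ⊗ₜ[B] x) = p • x := fun p x => by simp [r]
  have hD : ∀ p x, D (p ⊗ₜ[B] x) = (Polynomial.X * p) ⊗ₜ[B] x - p ⊗ₜ[B] (Polynomial.X • x) := fun p x => by
    simp [D, ht, TensorProduct.smul_tmul']
    rfl
  let H0 : B[X] →ₗ[B] (N →ₗ[B] TensorProduct B B[X] N) := Polynomial.lsum fun i =>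
      LinearMap.toSpanSingleton B (N →ₗ[B] TensorProduct B B[X] N) (∑ j ∈ Finset.range i,
        (TensorProduct.mk B B[X] N (Polynomial.X ^ j)).comp (t ^ (i - 1 - j)))
  have hH0 : ∀ i x, H0 (Polynomial.X ^ i) x = ∑ j ∈ Finset.range i,
      (Polynomial.X ^ j : B[X]) ⊗ₜ[B] ((Polynomial.X : B[X]) ^ (i - 1 - j) • x) := by
    intro i x
    have htp : ∀ n x, (t ^ n) x = (Polynomial.X : B[X]) ^ n • x := by
      intro n
      induction n with
      | zero => simp
      | succ n ih => intro x; rw [pow_succ', Module.End.mul_apply, ih, ht, smul_smul, ← pow_succ']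
    simp [H0, Polynomial.lsum_apply, Polynomial.X_pow_eq_monomial, Polynomial.sum_monomial_index, htp]
  let Hh : TensorProduct B B[X] N →ₗ[B] TensorProduct B B[X] N := TensorProduct.lift H0
  have hH : ∀ i x, Hh ((Polynomial.X ^ i : B[X]) ⊗ₜ[B] x) = ∑ j ∈ Finset.range i,
      (Polynomial.X ^ j : B[X]) ⊗ₜ[B] ((Polynomial.X : B[X]) ^ (i - 1 - j) • x) := by
    intro i x; simp [Hh, hH0]
  have ind : ∀ {f g : TensorProduct B B[X] N →ₗ[B] TensorProduct B B[X] N}, (∀ (i : ℕ) x, f ((Polynomial.X ^ i : B[X]) ⊗ₜ[B] x) = g ((Polynomial.X ^ i : B[X]) ⊗ₜ[B] x)) → f = g := by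
    intro f g h
    apply TensorProduct.ext
    ext i x
    simpa [Polynomial.X_pow_eq_monomial] using h i x
  have e1 : Hh ∘ₗ (D.restrictScalars B) = LinearMap.id := by
    apply ind
    intro i x
    simp only [LinearMap.comp_apply, LinearMap.restrictScalars_apply, hD, map_sub, LinearMap.id_apply]
    rw [← pow_succ', hH, hH, Finset.sum_range_succ]
    simp only [Nat.add_sub_cancel, Nat.sub_self, pow_zero, one_smul]
    rw [add_sub_right_comm, add_eq_right, sub_eq_zero]
    apply Finset.sum_congr rfl
    intro j hj
    rw [smul_smul, ← pow_succ]
    congr 3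
    have := Finset.mem_range.1 hj
    omega
  have e2 : (D.restrictScalars B) ∘ₗ Hh + (TensorProduct.mk B B[X] N 1) ∘ₗ (r.restrictScalars B) = LinearMap.id := by
    apply ind
    intro i x
    simp only [LinearMap.add_apply, LinearMap.comp_apply, LinearMap.restrictScalars_apply, hr, hH, map_sum, hD,
      TensorProduct.mk_apply, LinearMap.id_apply]
    have : ∀ j ∈ Finset.range i, ((Polynomial.X * Polynomial.X ^ j : B[X]) ⊗ₜ[B] ((Polynomial.X : B[X]) ^ (i - 1 - j) • x) - (Polynomial.X ^ j : B[X]) ⊗ₜ[B] ((Polynomial.X : B[X]) • (Polynomial.X : B[X]) ^ (i - 1 - j) • x)) =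
        (fun j => (Polynomial.X ^ j : B[X]) ⊗ₜ[B] ((Polynomial.X : B[X]) ^ (i - j) • x)) (j + 1) - (fun j => (Polynomial.X ^ j : B[X]) ⊗ₜ[B] ((Polynomial.X : B[X]) ^ (i - j) • x)) j := by
      intro j hj
      have := Finset.mem_range.1 hj
      simp only [smul_smul, ← pow_succ']
      congr 4 <;> omega
    have h3 := (Finset.sum_congr rfl this).trans (Finset.sum_range_sub _ i)
    refine (congrArg (· + _) h3).trans ?_
    simp
  refine ⟨TensorProduct B B[X] N, inferInstance, inferInstance, D, r, inferInstance, ?_, ?_, ?_⟩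
  · exact Function.LeftInverse.injective (g := Hh) fun x => LinearMap.congr_fun e1 x
  · intro y
    constructor
    · intro hy
      refine ⟨Hh y, ?_⟩
      have := LinearMap.congr_fun e2 y
      simpa [hy] using this
    · rintro ⟨z, rfl⟩
      have : (r ∘ₗ D).restrictScalars B = 0 := by
        apply TensorProduct.ext
        ext i x
        simp only [LinearMap.compr₂ₛₗ_apply, LinearMap.comp_apply, TensorProduct.mk_apply,
          LinearMap.restrictScalars_apply, hD, map_sub, hr, mul_smul, LinearMap.zero_apply]
        rw [sub_eq_zero, smul_comm]
      exact LinearMap.congr_fun this z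
  · intro x
    exact ⟨1 ⊗ₜ x, by simp [hr]⟩

open scoped Polynomial in
theorem GlDim.polynomial {B : Type} [CommRing B] {n : ℕ} (h : GlDim B n) : GlDim B[X] (n + 1) := by
  intro M _ _ ⟨P, _, _, N, _, _, i, q, hP, hi, hiq, hq, hN⟩
  letI : Module B N := Module.compHom N (algebraMap B B[X])
  haveI : IsScalarTower B B[X] N := ⟨fun a b x => by
      rw [Algebra.smul_def, mul_smul]; rfl⟩
  haveI := h N (IsSyz.restrict n N hN)
  obtain ⟨K, _, _, j, r, hK, hj, hjr, hr⟩ := koszul1 (B := B) (N := N)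
  exact schanuel i q hi hiq j r hj hjr hr hq

theorem GlDim.of_equiv {A B : Type} [CommRing A] [CommRing B] (e : A ≃+* B) {n : ℕ} (h : GlDim A n) :
    GlDim B n := by
  intro M _ _ hM
  letI : Algebra A B := e.toRingHom.toAlgebra
  letI : Module A M := Module.compHom M (algebraMap A B)
  haveI : IsScalarTower A B M := ⟨fun a b x => by
      rw [Algebra.smul_def, mul_smul]; rfl⟩
  haveI : Module.Projective A B := Module.Projective.of_equiv
    (AlgEquiv.ofRingEquiv (f := e) (fun _ => rfl) : A ≃ₐ[A] B).toLinearEquiv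
  haveI := h M (IsSyz.restrict n M hM)
  haveI := RingHomInvPair.of_ringEquiv e
  haveI := (RingHomInvPair.of_ringEquiv e).symm
  let e' : M ≃ₛₗ[(e : A →+* B)] M := { AddEquiv.refl M with map_smul' := fun a x => rfl }
  exact Module.Projective.of_equiv e'

theorem GlDim_mvPolynomial (K : Type) [Field K] (n : ℕ) : GlDim (MvPolynomial (Fin n) K) n := by
  induction n with
  | zero =>
    refine GlDim.of_equiv (MvPolynomial.isEmptyRingEquiv K (Fin 0)).symm ?_
    intro M _ _ _
    infer_instance
  | succ n ih => exact GlDim.of_equiv (MvPolynomial.finSuccEquiv K n).symm.toRingEquiv ih.polynomial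

end PartA
end H16

namespace H16
section PartG1
open CategoryTheory

theorem ext_vanish {R X : Type} [CommRing R] [AddCommGroup X] [Module R X] (m : ℕ → ℕ)
    (δ : ∀ n, (Fin (m (n+1)) → R) →ₗ[R] (Fin (m n) → R)) (ε : (Fin (m 0) → R) →ₗ[R] X)
    (hε : Function.Surjective ε) (h0 : Function.Exact (δ 0) ε)
    (h1 : ∀ n, Function.Exact (δ (n+1)) (δ n)) (Y : Type) [AddCommGroup Y] [Module R Y] (i : ℕ)
    (hY : Subsingleton (((Ext R (ModuleCat R) (i+1)).obj (Opposite.op (ModuleCat.of R X))).obj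
          (ModuleCat.of R Y))) (φ : (Fin (m (i+1)) → R) →ₗ[R] Y) (hφ : φ ∘ₗ δ (i+1) = 0) :
    ∃ ψ : (Fin (m i) → R) →ₗ[R] Y, φ = ψ ∘ₗ δ i := by
  let F : ℕ → ModuleCat R := fun n => ModuleCat.of R (Fin (m n) → R)
  let D : ∀ n, F (n+1) ⟶ F n := fun n => ModuleCat.ofHom (δ n)
  have hDD : ∀ n, D (n+1) ≫ D n = 0 := fun n => by
    apply ModuleCat.hom_ext
    exact LinearMap.ext fun x => (h1 n).apply_apply_eq_zero x
  let C : ChainComplex (ModuleCat R) ℕ := ChainComplex.of F D hDD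
  have hC : ∀ n, C.d (n+1) n = D n := fun n => ChainComplex.of_d _ _ _
  have hCε : C.d 1 0 ≫ ModuleCat.ofHom ε = 0 := by
      rw [hC]
      apply ModuleCat.hom_ext
      exact LinearMap.ext fun x => h0.apply_apply_eq_zero x
  have hπ : ((ChainComplex.toSingle₀Equiv C (ModuleCat.of R X)).symm ⟨ModuleCat.ofHom ε, hCε⟩).f 0
     = ModuleCat.ofHom ε := ChainComplex.toSingle₀Equiv_symm_apply_f_zero _ _
  let P : ProjectiveResolution (ModuleCat.of R X) :=
  { complex := C
    projective := fun n => (inferInstance : Projective (F n))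
    π := (ChainComplex.toSingle₀Equiv C (ModuleCat.of R X)).symm ⟨ModuleCat.ofHom ε, hCε⟩
    quasiIso := ⟨fun n => by
      cases n with
      | zero =>
        rw [ChainComplex.quasiIsoAt₀_iff, ShortComplex.quasiIso_iff_of_zeros']
        · refine ⟨?_, ?_⟩
          · rw [ShortComplex.moduleCat_exact_iff]
            intro x hx
            have hx' : ε x = 0 := by
              refine Eq.trans ?_ hx
              exact (congrArg (fun f : F 0 ⟶ ModuleCat.of R X => f.hom x) hπ).symm
            obtain ⟨y, hy⟩ := (h0 x).1 hx'
            refine ⟨y, ?_⟩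
            refine Eq.trans ?_ hy
            exact congrArg (fun f => ModuleCat.Hom.hom f y) (hC 0)
          · refine (ModuleCat.epi_iff_surjective _).2 ?_
            intro x
            obtain ⟨y, hy⟩ := hε x
            refine ⟨y, ?_⟩
            refine Eq.trans ?_ hy
            exact congrArg (fun f : F 0 ⟶ ModuleCat.of R X => f.hom y) hπ
        all_goals rfl
      | succ n =>
        rw [quasiIsoAt_iff_exactAt']
        · rw [HomologicalComplex.exactAt_iff' _ (n+2) (n+1) n (by simp) (by simp), ShortComplex.moduleCat_exact_iff]
          intro x hx
          change (C.d (n+1) n).hom x = 0 at hx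
          rw [hC] at hx
          obtain ⟨y, hy⟩ := (h1 n x).1 hx
          refine ⟨y, ?_⟩
          change (C.d (n+2) (n+1)).hom y = x
          rw [hC]
          exact hy
        · apply ChainComplex.exactAt_succ_single_obj⟩ }
  have key : (P.complex.linearYonedaObj R (ModuleCat.of R Y)).ExactAt (i+1) := by
    rw [HomologicalComplex.exactAt_iff_isZero_homology]
    refine Limits.IsZero.of_iso ?_ (P.isoExt (i+1) (ModuleCat.of R Y)).symm
    exact ModuleCat.isZero_of_subsingleton _
  rw [HomologicalComplex.exactAt_iff' _ i (i+1) (i+2) (by simp) (by simp),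
    ShortComplex.moduleCat_exact_iff] at key
  obtain ⟨ψ, hψ⟩ := key (ModuleCat.ofHom φ : F (i+1) ⟶ ModuleCat.of R Y) (by
    change C.d (i+2) (i+1) ≫ ModuleCat.ofHom φ = 0
    rw [hC]
    apply ModuleCat.hom_ext
    exact hφ)
  change C.d (i+1) i ≫ ψ = _ at hψ
  rw [hC] at hψ
  refine ⟨ModuleCat.Hom.hom ψ, ?_⟩
  have := congrArg ModuleCat.Hom.hom hψ
  exact this.symm
end PartG1
end H16

set_option linter.style.haveILetI false
set_option linter.unusedSectionVars false
namespace H16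
section PartG2

theorem exists_res (R X : Type) [CommRing R] [IsNoetherianRing R] [AddCommGroup X] [Module R X]
    [Module.Finite R X] : ∃ (m : ℕ → ℕ)
    (δ : ∀ n, (Fin (m (n+1)) → R) →ₗ[R] (Fin (m n) → R)) (ε : (Fin (m 0) → R) →ₗ[R] X),
    Function.Surjective ε ∧ Function.Exact (δ 0) ε ∧
    ∀ n, Function.Exact (δ (n+1)) (δ n) := by
  obtain ⟨m0, ε, hε⟩ := Module.Finite.exists_fin' R X
  have next : ∀ z : (Σ m : ℕ, Submodule R (Fin m → R)), ∃ z' : (Σ m' : ℕ, (Fin m' → R) →ₗ[R] (Fin z.1 → R)),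
      LinearMap.range z'.2 = z.2 := by
    rintro ⟨m, K⟩
    obtain ⟨m', f, hf⟩ := Module.Finite.exists_fin' R K
    exact ⟨⟨m', K.subtype ∘ₗ f⟩, by rw [LinearMap.range_comp, LinearMap.range_eq_top.2 hf]; simp⟩
  choose nx hnx using next
  let sq : ℕ → (Σ m : ℕ, Submodule R (Fin m → R)) := fun n => Nat.rec ⟨m0, LinearMap.ker ε⟩
    (fun _ z => ⟨(nx z).1, LinearMap.ker (nx z).2⟩) n
  refine ⟨fun n => (sq n).1, fun n => (nx (sq n)).2, ε, hε, ?_, fun n => ?_⟩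
  · rw [LinearMap.exact_iff]
    exact (hnx (sq 0)).symm
  · rw [LinearMap.exact_iff]
    exact (hnx (sq (n+1))).symm

variable {R : Type} [CommRing R] (m : ℕ → ℕ)
    (δ : ∀ n, (Fin (m (n+1)) → R) →ₗ[R] (Fin (m n) → R))

/-- cocycles -/
def cyc (T : Type) [CommRing T] [Algebra R T] (i : ℕ) :
    Submodule T ((Fin (m i) → R) →ₗ[R] T) where
  carrier := {φ | φ ∘ₗ δ i = 0}
  zero_mem' := by simp
  add_mem' {a b} ha hb := by
    simp only [Set.mem_ofPred_eq] at *
    rw [LinearMap.add_comp, ha, hb, add_zero]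
  smul_mem' c a ha := by
    simp only [Set.mem_ofPred_eq] at *
    rw [LinearMap.smul_comp, ha, smul_zero]

/-- coboundary map -/
def cobd (T : Type) [CommRing T] [Algebra R T] (i : ℕ) :
    ((Fin (m i) → R) →ₗ[R] T) →ₗ[T] ((Fin (m (i+1)) → R) →ₗ[R] T) where
  toFun φ := φ ∘ₗ δ i
  map_add' _ _ := LinearMap.add_comp _ _ _
  map_smul' _ _ := LinearMap.smul_comp _ _ _

/-- vanishing of the `(i+1)`-st cohomology -/
def Van (T : Type) [AddCommGroup T] [Module R T] (i : ℕ) : Prop :=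
  ∀ φ : (Fin (m (i+1)) → R) →ₗ[R] T, φ ∘ₗ δ (i+1) = 0 →
    ∃ ψ : (Fin (m i) → R) →ₗ[R] T, φ = ψ ∘ₗ δ i

theorem hom_proj (T : Type) [CommRing T] [Algebra R T] (i : ℕ) :
    Module.Projective T ((Fin i → R) →ₗ[R] T) :=
  Module.Projective.of_equiv ((Pi.basisFun R (Fin i)).constr T (M' := T))

theorem hom_fin (T : Type) [CommRing T] [Algebra R T] (i : ℕ) :
    Module.Finite T ((Fin i → R) →ₗ[R] T) :=
  Module.Finite.equiv ((Pi.basisFun R (Fin i)).constr T (M' := T))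

theorem IsSyz.of_equiv {A : Type} [CommRing A] {n : ℕ} {M N : Type} [AddCommGroup M] [Module A M]
    [AddCommGroup N] [Module A N] (e : M ≃ₗ[A] N) (h : IsSyz A n M) : IsSyz A n N := by
  cases n with
  | zero => trivial
  | succ n =>
    obtain ⟨P, _, _, Q, _, _, i, q, hP, hi, hiq, hq, hN⟩ := h
    refine ⟨P, _, _, Q, _, _, i ∘ₗ e.symm.toLinearMap, q, hP, hi.comp e.symm.injective, ?_, hq, hN⟩
    rw [LinearMap.exact_iff] at hiq ⊢
    rw [hiq, LinearMap.range_comp, LinearEquiv.range, Submodule.map_top]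

theorem cyc_syz (hδ : ∀ n, Function.Exact (δ (n+1)) (δ n)) (T : Type) [CommRing T] [Algebra R T] (n : ℕ) : ∀ i,
    (∀ j, i ≤ j → j + 2 < i + n → Van m δ T j) → IsSyz T n (cyc m δ T i) := by
  induction n with
  | zero => intros; trivial
  | succ n ih =>
    intro i hV
    refine ⟨_, inferInstance, inferInstance, LinearMap.range (cobd m δ T i), inferInstance, inferInstance,
      (cyc m δ T i).subtype, (cobd m δ T i).rangeRestrict, hom_proj T _, Subtype.val_injective, ?_,
      LinearMap.surjective_rangeRestrict _, ?_⟩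
    · rw [LinearMap.exact_iff, LinearMap.ker_rangeRestrict, Submodule.range_subtype]
      rfl
    · obtain _ | _ | n := n
      · trivial
      · refine ⟨_, inferInstance, inferInstance, _ ⧸ LinearMap.range (cobd m δ T i), inferInstance, inferInstance,
          (LinearMap.range (cobd m δ T i)).subtype, Submodule.mkQ _, hom_proj T _, Subtype.val_injective, ?_,
            Submodule.mkQ_surjective _, trivial⟩
        rw [LinearMap.exact_iff]; simp
      · have : LinearMap.range (cobd m δ T i) = cyc m δ T (i+1) := by
          ext φ
          constructor
          · rintro ⟨ψ, rfl⟩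
            change (ψ ∘ₗ δ i) ∘ₗ δ (i+1) = 0
            ext x
            simp [(hδ i).apply_apply_eq_zero]
          · intro h
            obtain ⟨ψ, hψ⟩ := hV i le_rfl (by omega) φ h
            exact ⟨ψ, hψ.symm⟩
        rw [this]
        exact ih (i+1) fun j h1 h2 => hV j (by omega) (by omega)

/-- extension lemma -/
theorem extend {A P N : Type} [CommRing A] [Algebra A R] [AddCommGroup P] [AddCommGroup N]
    [Module R P] [Module R N] [Module A P] [Module A N] [IsScalarTower A R P] [IsScalarTower A R N]
    [Module.Projective A N] (τ : R →ₗ[A] A)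
    (hτ : ∀ φ : R →ₗ[A] A, ∃ s, ∀ r, φ r = τ (s * r)) (hτ' : ∀ s, (∀ r, τ (s * r) = 0) → s = 0)
    (q : P →ₗ[R] N) (hq : Function.Surjective q) (M : Submodule R P) (hM : M = LinearMap.ker q)
    (l : M →ₗ[R] R) : ∃ L : P →ₗ[R] R, ∀ x : M, L x = l x := by
  subst hM
  obtain ⟨s, hs⟩ := Module.projective_lifting_property (q.restrictScalars A) LinearMap.id hq
  have hs' : ∀ x, q (s x) = x := fun x => LinearMap.congr_fun hs x
  have hmem : ∀ x, x - s (q x) ∈ LinearMap.ker q := fun x => by simp [hs']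
  let pr : P →ₗ[A] LinearMap.ker q :=
  { toFun := fun x => ⟨x - s (q x), hmem x⟩
    map_add' := fun x y => Subtype.ext (by simp; abel)
    map_smul' := fun c x => Subtype.ext (by
      have : q (c • x) = c • q x := (q.restrictScalars A).map_smul c x
      simp [this, smul_sub]) }
  have hpr : ∀ x : LinearMap.ker q, pr x = x := fun x => Subtype.ext (by
    change (x : P) - s (q x) = x
    rw [LinearMap.mem_ker.1 x.2]; simp)
  let μ : P →ₗ[A] A := τ ∘ₗ (l.restrictScalars A) ∘ₗ pr
  have h1 : ∀ p : P, ∃ s, ∀ r : R, μ (r • p) = τ (s * r) := fun p =>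
    hτ (μ ∘ₗ (LinearMap.toSpanSingleton R P p).restrictScalars A)
  choose L hL using h1
  have uq : ∀ a b, (∀ r, τ (a * r) = τ (b * r)) → a = b := fun a b h =>
    sub_eq_zero.1 (hτ' _ fun r => by rw [sub_mul, map_sub, h, sub_self])
  refine ⟨{ toFun := L, map_add' := fun x y => uq _ _ fun r => ?_, map_smul' := fun c x => uq _ _ fun r => ?_ }, ?_⟩
  · rw [← hL, add_mul, map_add, ← hL, ← hL, smul_add, map_add]
  · rw [← hL, smul_smul, hL, RingHom.id_apply, smul_eq_mul]
    congr 1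
    ring
  · intro x
    apply uq
    intro r
    change τ (L x * r) = _
    rw [← hL]
    change τ (l (pr (r • x : LinearMap.ker q))) = _
    rw [hpr, map_smul, smul_eq_mul, mul_comm]

theorem eval_rep {n : ℕ} (L : ((Fin n → R) →ₗ[R] R) →ₗ[R] R) : ∃ u, ∀ φ, L φ = φ u := by
  refine ⟨fun j => L (LinearMap.proj j), fun φ => ?_⟩
  have : φ = ∑ j, φ (Pi.single j 1) • (LinearMap.proj j : (Fin n → R) →ₗ[R] R) := by
    apply LinearMap.pi_ext'
    intro i
    ext
    simp [Pi.single_apply]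
  conv_lhs => rw [this]
  rw [LinearMap.pi_apply_eq_sum_univ φ]
  simp only [map_sum, map_smul, smul_eq_mul]
  refine Finset.sum_congr rfl fun x _ => ?_
  rw [mul_comm]
  congr 2
  ext j
  simp [Pi.single_apply, eq_comm]

theorem factor_surj {P N Q : Type} [AddCommGroup P] [AddCommGroup N] [AddCommGroup Q]
    [Module R P] [Module R N] [Module R Q] (q : P →ₗ[R] N) (hq : Function.Surjective q)
    (l : P →ₗ[R] Q) (h : LinearMap.ker q ≤ LinearMap.ker l) :
    ∃ θ : N →ₗ[R] Q, ∀ x, θ (q x) = l x := by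
  refine ⟨(Submodule.liftQ _ _ h) ∘ₗ (q.quotKerEquivOfSurjective hq).symm.toLinearMap, fun φ => ?_⟩
  have : (q.quotKerEquivOfSurjective hq).symm (q φ) = Submodule.Quotient.mk φ := by
    rw [LinearEquiv.symm_apply_eq]; rfl
  rw [LinearMap.comp_apply, LinearEquiv.coe_coe, this, Submodule.liftQ_apply]

set_option maxHeartbeats 1000000 in
theorem abstract_main {A R S X : Type} [CommRing A] [CommRing R] [CommRing S] [Algebra A R]
    [Algebra R S] [IsNoetherianRing R] [IsNoetherianRing S] [AddCommGroup X] [Module R X]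
    (m : ℕ → ℕ)
    (δ : ∀ n, (Fin (m (n+1)) → R) →ₗ[R] (Fin (m n) → R)) (ε : (Fin (m 0) → R) →ₗ[R] X)
    (hε : Function.Surjective ε) (h0 : Function.Exact (δ 0) ε)
    (hδ : ∀ n, Function.Exact (δ (n+1)) (δ n))
    (n d : ℕ) (hA : GlDim A n) (hS : GlDim S d) [Module.Projective A R]
    (ρ : S →ₗ[R] R) (hρ : ∀ r, ρ (algebraMap R S r) = r) (τ : R →ₗ[A] A)
    (hτ : ∀ φ : R →ₗ[A] A, ∃ s, ∀ r, φ r = τ (s * r)) (hτ' : ∀ s, (∀ r, τ (s * r) = 0) → s = 0)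
    (e : (S →ₗ[R] R) ≃ₗ[R] S)
    (hVR : ∀ i, Van m δ R i) (hVS : ∀ i, i + 2 < d → Van m δ S i) :
    ∃ (N : ℕ) (ι : X →ₗ[R] (Fin N → S)) (π : (Fin N → S) →ₗ[R] X), π ∘ₗ ι = LinearMap.id := by
  have hZA : ∀ i, Module.Projective A (cyc m δ R i) := fun i =>
    hA _ (IsSyz.restrict n _ (cyc_syz m δ hδ R n i fun j _ _ => hVR j))
  have hZS : Module.Projective S (cyc m δ S 0) :=
    hS _ (cyc_syz m δ hδ S d 0 fun j _ h => hVS j (by omega))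
  -- the maps `q_i : F_i^* → Z_{i+1}`
  have hq0 : ∀ i (φ : (Fin (m i) → R) →ₗ[R] R), cobd m δ R i φ ∈ cyc m δ R (i+1) := fun i φ => by
    change (φ ∘ₗ δ i) ∘ₗ δ (i+1) = 0
    ext x
    simp [(hδ i).apply_apply_eq_zero]
  have hqE : ∃ q : ∀ i, ((Fin (m i) → R) →ₗ[R] R) →ₗ[R] cyc m δ R (i+1),
      (∀ i, Function.Surjective (q i)) ∧ (∀ i, cyc m δ R i = LinearMap.ker (q i)) ∧
      ∀ i φ, (q i φ).1 = φ ∘ₗ δ i := by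
    refine ⟨fun i => (cobd m δ R i).codRestrict _ (hq0 i), fun i => ?_, fun i => ?_, fun i φ => rfl⟩
    · rintro ⟨φ, hφ⟩
      obtain ⟨ψ, hψ⟩ := hVR i φ hφ
      exact ⟨ψ, Subtype.ext hψ.symm⟩
    · ext φ
      rw [LinearMap.ker_codRestrict]
      rfl
  obtain ⟨q, hqs, hqk, hqv⟩ := hqE
  have hext : ∀ i (l : cyc m δ R i →ₗ[R] R), ∃ u, ∀ φ : cyc m δ R i, l φ = φ.1 u := fun i l => by
    haveI := hZA (i+1)
    obtain ⟨L, hL⟩ := extend (A := A) (P := (Fin (m i) → R) →ₗ[R] R)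
      (N := cyc m δ R (i+1)) τ hτ hτ' (q i) (hqs i) _ (hqk i) l
    obtain ⟨u, hu⟩ := eval_rep L
    exact ⟨u, fun φ => by rw [← hL, hu]⟩
  let B : (Fin (m 0) → R) →ₗ[R] (cyc m δ R 0 →ₗ[R] R) :=
    (LinearMap.lcomp R R (cyc m δ R 0).subtype) ∘ₗ LinearMap.applyₗ
  have hB : ∀ u φ, B u φ = φ.1 u := fun u φ => rfl
  have hBs : Function.Surjective B := fun l => by
    obtain ⟨u, hu⟩ := hext 0 l
    exact ⟨u, LinearMap.ext fun φ => by rw [hB, hu]⟩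
  have hBk : LinearMap.ker ε = LinearMap.ker B := by
    ext u
    rw [LinearMap.mem_ker, LinearMap.mem_ker]
    constructor
    · intro hu
      obtain ⟨v, rfl⟩ := (h0 u).1 hu
      ext φ
      exact LinearMap.congr_fun φ.2 v
    · intro hu
      rw [h0]
      have hu' : LinearMap.ker (q 0) ≤ LinearMap.ker (LinearMap.applyₗ u : ((Fin (m 0) → R) →ₗ[R] R) →ₗ[R] R) := by
        rw [← hqk]
        intro φ hφ
        exact LinearMap.congr_fun hu ⟨φ, hφ⟩
      obtain ⟨θ, hθ⟩ := factor_surj (P := (Fin (m 0) → R) →ₗ[R] R) (N := cyc m δ R (0+1)) (q 0) (hqs 0) (LinearMap.applyₗ u : ((Fin (m 0) → R) →ₗ[R] R) →ₗ[R] R) hu'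
      obtain ⟨v, hv⟩ := hext 1 θ
      refine ⟨v, ?_⟩
      ext j
      have := hθ (LinearMap.proj j)
      rw [hv, hqv] at this
      exact this
  let eX : X ≃ₗ[R] (cyc m δ R 0 →ₗ[R] R) := (ε.quotKerEquivOfSurjective hε).symm ≪≫ₗ
    Submodule.quotEquivOfEq _ _ hBk ≪≫ₗ B.quotKerEquivOfSurjective hBs
  haveI := hom_fin (R := R) S (m 0)
  haveI : Module.Finite S (cyc m δ S 0) := inferInstance
  obtain ⟨N, p, hp⟩ := Module.Finite.exists_fin' S (cyc m δ S 0)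
  obtain ⟨s, hs⟩ := Module.projective_lifting_property p LinearMap.id hp
  let a : cyc m δ R 0 →ₗ[R] cyc m δ S 0 :=
  { toFun := fun φ => ⟨Algebra.linearMap R S ∘ₗ φ.1, by
      change (Algebra.linearMap R S ∘ₗ φ.1) ∘ₗ δ 0 = 0
      rw [LinearMap.comp_assoc, show φ.1 ∘ₗ δ 0 = 0 from φ.2, LinearMap.comp_zero]⟩
    map_add' := fun x y => Subtype.ext (by simp [LinearMap.comp_add])
    map_smul' := fun c x => Subtype.ext (by simp [LinearMap.comp_smul]) }
  let b : cyc m δ S 0 →ₗ[R] cyc m δ R 0 :=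
  { toFun := fun φ => ⟨ρ ∘ₗ φ.1, by
      change (ρ ∘ₗ φ.1) ∘ₗ δ 0 = 0
      rw [LinearMap.comp_assoc, show φ.1 ∘ₗ δ 0 = 0 from φ.2, LinearMap.comp_zero]⟩
    map_add' := fun x y => Subtype.ext (by simp [LinearMap.comp_add])
    map_smul' := fun c x => Subtype.ext (by simp [LinearMap.comp_smul]) }
  have hba : ∀ x, b (a x) = x := fun x => Subtype.ext (LinearMap.ext fun y => hρ _)
  let i1 : cyc m δ R 0 →ₗ[R] (Fin N → S) := (s.restrictScalars R) ∘ₗ a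
  let p1 : (Fin N → S) →ₗ[R] cyc m δ R 0 := b ∘ₗ (p.restrictScalars R)
  have hp1 : p1 ∘ₗ i1 = LinearMap.id := LinearMap.ext fun x => by
    change b (p (s (a x))) = x
    rw [show p (s (a x)) = a x from LinearMap.congr_fun hs _, hba]
  let e2 : ((Fin N → S) →ₗ[R] R) ≃ₗ[R] (Fin N → S) :=
    (LinearMap.lsum R (fun _ : Fin N => S) R).symm ≪≫ₗ LinearEquiv.piCongrRight fun _ => e
  refine ⟨N, e2.toLinearMap ∘ₗ LinearMap.lcomp R R p1 ∘ₗ eX.toLinearMap,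
    eX.symm.toLinearMap ∘ₗ LinearMap.lcomp R R i1 ∘ₗ e2.symm.toLinearMap, ?_⟩
  ext x
  simp only [LinearMap.comp_apply, LinearEquiv.coe_coe, LinearEquiv.symm_apply_apply, LinearMap.id_apply]
  rw [LinearEquiv.symm_apply_eq]
  ext y
  simp only [LinearMap.lcomp_apply]
  exact congrArg (eX x) (LinearMap.congr_fun hp1 y)
end PartG2
end H16

set_option linter.unusedSectionVars false
namespace H16
section PartE

variable {A S : Type} [CommRing A] [IsDomain A] [UniqueFactorizationMonoid A]
  [CommRing S] [IsDomain S] [UniqueFactorizationMonoid S] [Algebra A S]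
  [Module.Finite A S] [FaithfulSMul A S]

theorem exists_mul_alg {A S : Type} [CommRing A] [IsDomain A] [CommRing S] [IsDomain S] [Algebra A S]
    [Module.Finite A S] [FaithfulSMul A S] (s : S) (hs : s ≠ 0) :
    ∃ (s' : S) (a : A), a ≠ 0 ∧ s * s' = algebraMap A S a := by
  have : Algebra.IsIntegral A S := inferInstance
  have : Algebra.IsAlgebraic A S := inferInstance
  obtain ⟨a, ha, h⟩ := (Algebra.IsAlgebraic.isAlgebraic (R := A) s).exists_nonzero_dvd (mem_nonZeroDivisors_of_ne_zero hs)
  obtain ⟨s', hs'⟩ := h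
  exact ⟨s', a, ha, hs'.symm⟩

theorem height_lemma (π t : S) (hπ : Prime π) (ht : ¬ π ∣ t) (p : A) (hp : Prime p) :
    ¬ (Ideal.comap (algebraMap A S) (Ideal.span {π, t}) ≤ Ideal.span {p}) := by
  intro h
  have hpp : (Ideal.span {p} : Ideal A).IsPrime := (Ideal.span_singleton_prime hp.ne_zero).2 hp
  obtain ⟨Q, hQ1, hQ2, hQ3⟩ := Ideal.exists_ideal_over_prime_of_isIntegral (Ideal.span {p}) (Ideal.span {π, t}) h
  have hππ : (Ideal.span {π} : Ideal S).IsPrime := (Ideal.span_singleton_prime hπ.ne_zero).2 hπ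
  have hle : Ideal.span {π} ≤ Q := le_trans (Ideal.span_mono (by simp)) hQ1
  have htQ : t ∈ Q := hQ1 (Ideal.subset_span (by simp))
  have hlt := Ideal.comap_lt_comap_of_integral_mem_sdiff (R := A) hle (x := t)
    ⟨htQ, fun h => ht (Ideal.mem_span_singleton.1 h)⟩ (Algebra.IsIntegral.isIntegral t)
  rw [hQ3] at hlt
  obtain ⟨s', a, ha, haa⟩ := exists_mul_alg (A := A) π hπ.ne_zero
  have hne : Ideal.comap (algebraMap A S) (Ideal.span {π}) ≠ ⊥ := by
    intro h0
    have : a ∈ Ideal.comap (algebraMap A S) (Ideal.span {π}) := by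
      rw [Ideal.mem_comap, ← haa]
      exact Ideal.mul_mem_right _ _ (Ideal.mem_span_singleton_self π)
    rw [h0] at this
    exact ha this
  obtain ⟨x, hx, hxp⟩ := Ideal.IsPrime.exists_mem_prime_of_ne_bot (Ideal.comap_isPrime (algebraMap A S) (Ideal.span {π})) hne
  have h1 : p ∣ x := Ideal.mem_span_singleton.1 (hlt.le hx)
  have h2 : x ∣ p := (hp.associated_of_dvd hxp h1).symm.dvd
  apply lt_irrefl (Ideal.span {p} : Ideal A)
  refine lt_of_le_of_lt ?_ hlt
  rw [Ideal.span_singleton_le_iff_mem]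
  exact Ideal.mem_of_dvd _ h2 hx

theorem div_lemma (π t : S) (hπ : Prime π) (ht : ¬ π ∣ t) (σ μ : S →ₗ[A] A)
    (h : ∀ x, σ (t * x) = μ (π * x)) : ∃ φ : S →ₗ[A] A, ∀ x, σ x = φ (π * x) := by
  obtain ⟨π', a, ha, haa⟩ := exists_mul_alg (A := A) π hπ.ne_zero
  have key : ∀ x, a ∣ σ (π' * x) := by
    intro x
    by_contra hac
    obtain ⟨a', b', c', hrel, h1, h2⟩ := UniqueFactorizationMonoid.exists_reduced_factors a ha (σ (π' * x))
    have hau : ¬ IsUnit a' := by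
      intro hu
      apply hac
      rw [← h1, ← h2]
      exact mul_dvd_mul_left _ (hu.dvd)
    have ha0 : a' ≠ 0 := by rintro rfl; exact ha (by rw [← h1, mul_zero])
    have hc0 : c' ≠ 0 := by rintro rfl; exact ha (by rw [← h1, zero_mul])
    obtain ⟨p, hp, hpa⟩ := WfDvdMonoid.exists_irreducible_factor hau ha0
    refine height_lemma π t hπ ht p hp.prime ?_
    intro b hb
    rw [Ideal.mem_comap, Ideal.mem_span_pair] at hb
    obtain ⟨u, v, huv⟩ := hb
    rw [Ideal.mem_span_singleton]
    refine hpa.trans ?_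
    have h3 : b * σ (π' * x) = a * (σ (u * x) + μ (v * x)) := by
      rw [← smul_eq_mul, ← map_smul, Algebra.smul_def, ← huv]
      have : (u * π + v * t) * (π' * x) = a • (u * x) + t * (π' * v * x) := by
        rw [Algebra.smul_def, ← haa]; ring
      rw [this, map_add, map_smul, h]
      have : π * (π' * v * x) = a • (v * x) := by
        rw [Algebra.smul_def, ← haa]; ring
      rw [this, map_smul, smul_eq_mul, smul_eq_mul]; ring
    rw [← h1, ← h2] at h3
    have h4 : a' ∣ b * b' := by
      rw [← mul_dvd_mul_iff_left hc0]
      exact ⟨σ (u * x) + μ (v * x), by rw [← h3]; ring⟩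
    exact hrel.dvd_of_dvd_mul_right h4
  choose f hf using key
  refine ⟨{ toFun := f, map_add' := fun x y => ?_, map_smul' := fun c x => ?_ }, fun x => ?_⟩
  · apply mul_left_cancel₀ ha
    rw [← hf, mul_add, map_add, hf, hf, mul_add]
  · apply mul_left_cancel₀ ha
    rw [← hf, mul_smul_comm, map_smul, hf, RingHom.id_apply, smul_eq_mul, smul_eq_mul]; ring
  · change σ x = f (π * x)
    apply mul_left_cancel₀ ha
    rw [← hf, ← mul_assoc, mul_comm π', haa, ← Algebra.smul_def, map_smul, smul_eq_mul]

/-- the action of `s` on a functional -/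
def act (s : S) (φ : S →ₗ[A] A) : S →ₗ[A] A := φ ∘ₗ LinearMap.mulLeft A s

theorem act_inj (s : S) (hs : s ≠ 0) (φ : S →ₗ[A] A) (h : ∀ x, φ (s * x) = 0) : φ = 0 := by
  obtain ⟨s', a, ha, haa⟩ := exists_mul_alg (A := A) s hs
  ext x
  have := h (s' * x)
  rw [← mul_assoc, haa, ← Algebra.smul_def, map_smul, smul_eq_mul] at this
  exact (mul_eq_zero.1 this).resolve_left ha

theorem exists_dual [IsNoetherianRing A] [Module.Free A S] : ∃ σ : S →ₗ[A] A, σ ≠ 0 ∧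
    (∀ φ : S →ₗ[A] A, ∃ s, ∀ x, φ x = σ (s * x)) := by
  classical
  -- submodules generated
  let cyc : (S →ₗ[A] A) → Submodule A (S →ₗ[A] A) := fun φ => LinearMap.range
    (({ toFun := fun s => φ ∘ₗ LinearMap.mulLeft A s, map_add' := fun x y => by ext; simp [add_mul], map_smul' := fun c x => by ext; simp } : S →ₗ[A] (S →ₗ[A] A)))
  have hcyc : ∀ φ ψ, ψ ∈ cyc φ ↔ ∃ s, ∀ x, ψ x = φ (s * x) := by
    intro φ ψ
    constructor
    · rintro ⟨s, rfl⟩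
      exact ⟨s, fun x => rfl⟩
    · rintro ⟨s, hs⟩
      exact ⟨s, LinearMap.ext fun x => (hs x).symm⟩
  let b := Module.Free.chooseBasis A S
  have hne : ∃ φ : S →ₗ[A] A, φ ≠ 0 := by
    by_contra! hh
    have h1 : (1 : S) = 0 := by
      apply b.repr.injective
      ext i
      have := LinearMap.congr_fun (hh (b.coord i)) 1
      simpa using this
    exact one_ne_zero h1
  obtain ⟨φ0, hφ0⟩ := hne
  obtain ⟨M, ⟨σ, hσ, rfl⟩, hmax⟩ := set_has_maximal_iff_noetherian.2 (inferInstance : IsNoetherian A (S →ₗ[A] A))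
    {M | ∃ φ, φ ≠ 0 ∧ cyc φ = M} ⟨_, φ0, hφ0, rfl⟩
  refine ⟨σ, hσ, fun ψ => ?_⟩
  by_cases hψ : ψ = 0
  · exact ⟨0, by simp [hψ]⟩
  -- rank one
  have hrk : ∃ s t : S, s ≠ 0 ∧ t ≠ 0 ∧ ∀ x, ψ (s * x) = σ (t * x) := by
    let f : S × S →ₗ[A] (S →ₗ[A] A) :=
    { toFun := fun z => ψ ∘ₗ LinearMap.mulLeft A z.1 - σ ∘ₗ LinearMap.mulLeft A z.2
      map_add' := fun x y => by ext; simp [add_mul]; ring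
      map_smul' := fun c x => by ext; simp [mul_sub] }
    have hf : ∀ z x, f z x = ψ (z.1 * x) - σ (z.2 * x) := fun z x => rfl
    have hni : ¬ Function.Injective f := by
      intro hi
      have h1 := LinearMap.finrank_le_finrank_of_injective hi
      rw [Module.finrank_prod, Module.finrank_linearMap_self] at h1
      have : 0 < Module.finrank A S := Module.finrank_pos
      omega
    rw [← LinearMap.ker_eq_bot, Submodule.eq_bot_iff] at hni
    push Not at hni
    obtain ⟨⟨s, t⟩, hst, hst0⟩ := hni
    have hst' : ∀ x, ψ (s * x) = σ (t * x) := fun x => by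
      have := LinearMap.congr_fun (LinearMap.mem_ker.1 hst) x
      rw [hf] at this
      exact sub_eq_zero.1 this
    refine ⟨s, t, ?_, ?_, hst'⟩
    · rintro rfl
      have ht : t ≠ 0 := by rintro rfl; exact hst0 rfl
      exact hσ (act_inj t ht σ fun x => by rw [← hst']; simp)
    · rintro rfl
      have hs : s ≠ 0 := by rintro rfl; exact hst0 rfl
      exact hψ (act_inj s hs ψ fun x => by rw [hst']; simp)
  obtain ⟨s0, t0, hs0, ht0, hst0⟩ := hrk
  obtain ⟨s, t, c, hrel, hs1, ht1⟩ := UniqueFactorizationMonoid.exists_reduced_factors s0 hs0 t0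
  have hc : c ≠ 0 := by rintro rfl; exact hs0 (by rw [← hs1, zero_mul])
  have hs : s ≠ 0 := by rintro rfl; exact hs0 (by rw [← hs1, mul_zero])
  have hst : ∀ x, ψ (s * x) = σ (t * x) := by
    have h1 : ψ ∘ₗ LinearMap.mulLeft A s - σ ∘ₗ LinearMap.mulLeft A t = 0 := by
      apply act_inj c hc
      intro x
      have := hst0 x
      rw [← hs1, ← ht1] at this
      simp only [LinearMap.sub_apply, LinearMap.comp_apply, LinearMap.mulLeft_apply]
      rw [← mul_assoc, ← mul_assoc, mul_comm s, mul_comm t, this, sub_self]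
    intro x
    exact sub_eq_zero.1 (LinearMap.congr_fun h1 x)
  by_cases hu : IsUnit s
  · obtain ⟨s', hs'⟩ := hu.exists_right_inv
    refine ⟨t * s', fun x => ?_⟩
    rw [mul_assoc, ← hst, ← mul_assoc, hs', one_mul]
  exfalso
  obtain ⟨π, hπ, s1, rfl⟩ := WfDvdMonoid.exists_irreducible_factor hu hs
  have hπt : ¬ π ∣ t := fun h => hπ.not_isUnit (hrel (Dvd.intro _ rfl) h)
  obtain ⟨φ, hφ⟩ := div_lemma π t hπ.prime hπt σ (ψ ∘ₗ LinearMap.mulLeft A s1) (fun x => by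
    rw [← hst]; simp only [LinearMap.comp_apply, LinearMap.mulLeft_apply]; congr 1; ring)
  have hφ0 : φ ≠ 0 := by
    rintro rfl
    exact hσ (LinearMap.ext fun x => by rw [hφ]; rfl)
  have hle : cyc σ ≤ cyc φ := by
    intro ψ hψ
    rw [hcyc] at hψ ⊢
    obtain ⟨u, hu⟩ := hψ
    exact ⟨π * u, fun x => by rw [hu, hφ, mul_assoc]⟩
  have hmem : φ ∈ cyc σ := by
    by_contra hn
    refine hmax (cyc φ) ⟨φ, hφ0, rfl⟩ (lt_of_le_of_ne hle ?_)
    intro he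
    apply hn
    rw [he, hcyc]
    exact ⟨1, by simp⟩
  rw [hcyc] at hmem
  obtain ⟨u, hu⟩ := hmem
  have h5 : π * u - 1 = 0 := by
    by_contra h6
    apply hσ
    apply act_inj _ h6
    intro x
    rw [sub_mul, map_sub, one_mul, sub_eq_zero]
    conv_rhs => rw [hφ, hu]
    congr 1; ring
  exact hπ.not_isUnit (IsUnit.of_mul_eq_one u (sub_eq_zero.1 h5))
end PartE
end H16

namespace H16
section PartB1
variable {S : Type} [CommRing S] {d : ℕ}

/-- permutable regular sequence -/
def Reg (h : Fin d → S) : Prop :=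
  ∀ (J : Set (Fin d)) (i : Fin d), i ∉ J → ∀ s, s * h i ∈ Ideal.span (h '' J) → s ∈ Ideal.span (h '' J)

theorem image_update {h : Fin d → S} {i : Fin d} {a : S} {J : Set (Fin d)} (hi : i ∉ J) :
    Function.update h i a '' J = h '' J := by
  apply Set.image_congr
  intro x hx
  rw [Function.update_of_ne]
  rintro rfl; exact hi hx

theorem mem_upd {h : Fin d → S} {i : Fin d} {a : S} {J : Set (Fin d)} (hi : i ∈ J) (x : S) :
    x ∈ Ideal.span (Function.update h i a '' J) ↔
      ∃ u, ∃ v ∈ Ideal.span (h '' (J \ {i})), x = a * u + v := by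
  have : Function.update h i a '' J = {a} ∪ h '' (J \ {i}) := by
    conv_lhs => rw [← Set.insert_sdiff_self_of_mem hi]
    rw [Set.image_insert_eq, image_update (by simp), Function.update_self]
    rfl
  rw [this, Ideal.span_union, Submodule.mem_sup]
  constructor
  · rintro ⟨y, hy, z, hz, rfl⟩
    obtain ⟨u, rfl⟩ := Ideal.mem_span_singleton.1 hy
    exact ⟨u, z, hz, rfl⟩
  · rintro ⟨u, v, hv, rfl⟩
    exact ⟨a * u, Ideal.mem_span_singleton.2 (Dvd.intro _ rfl), v, hv, rfl⟩

theorem Reg.mul {h : Fin d → S} {i : Fin d} {a b : S} (ha : Reg (Function.update h i a))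
    (hb : Reg (Function.update h i b)) : Reg (Function.update h i (a * b)) := by
  intro J j hj s hs
  by_cases hij : j = i
  · subst hij
    rw [image_update hj, Function.update_self] at *
    have h1 := hb J j hj (s * a)
    rw [image_update hj, Function.update_self] at h1
    have h2 := ha J j hj s
    rw [image_update hj, Function.update_self] at h2
    exact h2 (h1 (by rwa [mul_assoc]))
  rw [Function.update_of_ne hij] at hs
  by_cases hi : i ∈ J
  · have hbj : ∀ c, Reg (Function.update h i c) → ∀ s, (∃ u, ∃ v ∈ Ideal.span (h '' (J \ {i})), s * h j = c * u + v) →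
      ∃ u, ∃ v ∈ Ideal.span (h '' (J \ {i})), s = c * u + v := by
      intro c hc s
      have := hc J j hj s
      rwa [Function.update_of_ne hij, mem_upd hi, mem_upd hi] at this
    rw [mem_upd hi] at hs ⊢
    obtain ⟨w, v0, hv0, hs⟩ := hs
    obtain ⟨u, v, hv, rfl⟩ := hbj b hb s ⟨a * w, v0, hv0, by rw [hs]; ring⟩
    have h1 := hb (J \ {i}) i (by simp) (u * h j - a * w)
    rw [image_update (by simp), Function.update_self] at h1
    have h2 := h1 (by
      have : (u * h j - a * w) * b = v0 - v * h j := by linear_combination hs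
      rw [this]
      exact Ideal.sub_mem _ hv0 (Ideal.mul_mem_right _ _ hv))
    obtain ⟨u', v', hv', rfl⟩ := hbj a ha u ⟨w, _, h2, by ring⟩
    exact ⟨u', b * v' + v, Ideal.add_mem _ (Ideal.mul_mem_left _ _ hv') hv, by ring⟩
  · have := ha J j hj s
    rw [image_update hi] at *
    rw [Function.update_of_ne hij] at this
    exact this hs

theorem Reg.colon {h : Fin d → S} {i : Fin d} {a b : S} (hab : Reg (Function.update h i (a * b)))
    (u : S) (hu : u * b ∈ Ideal.span (Set.range (Function.update h i (a * b)))) :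
    u ∈ Ideal.span (Set.range (Function.update h i a)) := by
  rw [← Set.image_univ] at *
  rw [mem_upd (Set.mem_univ i)] at *
  obtain ⟨w, v, hv, h1⟩ := hu
  have h2 := hab (Set.univ \ {i}) i (by simp) (u - a * w)
  rw [image_update (by simp), Function.update_self] at h2
  refine ⟨w, u - a * w, h2 ?_, by ring⟩
  have : (u - a * w) * (a * b) = a * v := by linear_combination a * h1
  rw [this]
  exact Ideal.mul_mem_left _ _ hv

theorem pow_closure (m : Ideal S) {h : Fin d → S} {i : Fin d} {a b : S}
    (ha : ∃ N, m ^ N ≤ Ideal.span (Set.range (Function.update h i a)))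
    (hb : ∃ N, m ^ N ≤ Ideal.span (Set.range (Function.update h i b))) :
    ∃ N, m ^ N ≤ Ideal.span (Set.range (Function.update h i (a * b))) := by
  obtain ⟨N, hN⟩ := ha
  obtain ⟨M, hM⟩ := hb
  refine ⟨N + M, ?_⟩
  rw [pow_add]
  refine (Ideal.mul_mono hN hM).trans ?_
  rw [Ideal.mul_le]
  intro x hx y hy
  rw [← Set.image_univ, mem_upd (Set.mem_univ i)] at *
  obtain ⟨u, v, hv, rfl⟩ := hx
  obtain ⟨u', v', hv', rfl⟩ := hy
  exact ⟨u * u', a * u * v' + v * (b * u' + v'), Ideal.add_mem _ (Ideal.mul_mem_left _ _ hv') (Ideal.mul_mem_right _ _ hv), by ring⟩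

theorem multind {ι : Type} [DecidableEq ι] (Q : (Fin d → S) → Prop) (v : Fin d → ι → S)
    (hmul : ∀ h i a b, Q (Function.update h i a) → Q (Function.update h i b) →
      Q (Function.update h i (a * b)))
    (hbase : ∀ γ : Fin d → ι, Q fun i => v i (γ i)) (n : ℕ) : ∀ T : Fin d → Finset ι,
    (∀ i, (T i).Nonempty) → ∑ i, (T i).card ≤ n → Q fun i => ∏ g ∈ T i, v i g := by
  induction n with
  | zero =>
    intro T hT hn
    have : ∀ i : Fin d, False := fun i => by
      have h1 := (hT i).card_pos
      have h2 := Finset.single_le_sum (f := fun i => (T i).card) (fun _ _ => Nat.zero_le _) (Finset.mem_univ i)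
      omega
    have hb := hbase (fun i => (this i).elim)
    convert hb using 1
    funext i
    exact (this i).elim
  | succ n ih =>
    intro T hT hn
    by_cases hall : ∀ i, ∃ g, T i = {g}
    · choose γ hγ using hall
      convert hbase γ using 2 with i
      simp [hγ]
    · push Not at hall
      obtain ⟨i, hi⟩ := hall
      obtain ⟨g, hg⟩ := hT i
      have hne : ((T i).erase g).Nonempty := by
        rw [Finset.nonempty_iff_ne_empty]
        intro h0
        rw [Finset.erase_eq_empty_iff] at h0
        rcases h0 with h0 | h0
        · rw [h0] at hg; simp at hg
        · exact hi g h0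
      have hc := Finset.card_erase_add_one hg
      have hs : ∀ U : Finset ι, U.Nonempty → U.card < (T i).card →
          Q (Function.update (fun i => ∏ g ∈ T i, v i g) i (∏ g ∈ U, v i g)) := by
        intro U hU hUc
        have := ih (Function.update T i U) (fun j => by
          by_cases hj : j = i
          · subst hj; simpa using hU
          · simpa [hj] using hT j) (by
          have : ∑ j, (Function.update T i U j).card < ∑ j, (T j).card := by
            apply Finset.sum_lt_sum
            · intro j _
              by_cases hj : j = i
              · subst hj; simpa using hUc.le
              · simp [hj]
            · exact ⟨i, Finset.mem_univ i, by simpa using hUc⟩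
          omega)
        convert this using 1
        funext j
        by_cases hj : j = i
        · subst hj; simp
        · simp [hj]
      have h1 := hs {g} (by simp) (by have := hne.card_pos; simp; omega)
      have h2 := hs ((T i).erase g) hne (by omega)
      have := hmul _ _ _ _ h1 h2
      rw [Finset.prod_singleton, Finset.mul_prod_erase _ _ hg] at this
      convert this using 1
      rw [Function.update_eq_self_iff.2 rfl]
end PartB1
end H16

namespace H16
section PartB2
variable {k d}

/-- linear form with given coefficients -/
def lin (c : Fin d → k) : MvPolynomial (Fin d) k := ∑ j, c j • X j

theorem matAct_X (M : Matrix (Fin d) (Fin d) k) (i : Fin d) :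
    matAct k d M (X i) = lin fun j => M j i := by
  simp [matAct, lin]

theorem matAct_lin (M : Matrix (Fin d) (Fin d) k) (c : Fin d → k) :
    matAct k d M (lin c) = lin (M *ᵥ c) := by
  have h1 : matAct k d M (lin c) = ∑ i, c i • lin fun j => M j i := by
    rw [lin, map_sum]
    exact Finset.sum_congr rfl fun i _ => by rw [map_smul, matAct_X]
  rw [h1]
  simp only [lin, Finset.smul_sum, mulVec, dotProduct, Finset.sum_smul, smul_smul]
  rw [Finset.sum_comm]
  simp only [mul_comm]

theorem X_eq_lin (i : Fin d) : (X i : MvPolynomial (Fin d) k) = lin (Pi.single i 1) := by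
  simp [lin, Pi.single_apply]

theorem matAct_mul (M N : Matrix (Fin d) (Fin d) k) (s : MvPolynomial (Fin d) k) :
    matAct k d (M * N) s = matAct k d M (matAct k d N s) := by
  have : matAct k d (M * N) = (matAct k d M).comp (matAct k d N) := by
    apply MvPolynomial.algHom_ext
    intro i
    rw [AlgHom.comp_apply, X_eq_lin, matAct_lin, matAct_lin, matAct_lin, mulVec_mulVec]
  rw [this, AlgHom.comp_apply]

theorem matAct_one (s : MvPolynomial (Fin d) k) : matAct k d 1 s = s := by
  have : matAct k d 1 = AlgHom.id k _ := by
    apply MvPolynomial.algHom_ext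
    intro i
    rw [X_eq_lin, matAct_lin, one_mulVec, AlgHom.id_apply]
  rw [this, AlgHom.id_apply]

theorem lin_mem (c : Fin d → k) : lin c ∈ Ideal.span (Set.range (X : Fin d → MvPolynomial (Fin d) k)) := by
  refine Ideal.sum_mem _ fun j _ => ?_
  rw [smul_eq_C_mul]
  exact Ideal.mul_mem_left _ _ (Ideal.subset_span ⟨j, rfl⟩)

theorem lin_hom (c : Fin d → k) : (lin c).IsHomogeneous 1 := by
  refine IsHomogeneous.sum _ _ _ fun j _ => ?_
  rw [smul_eq_C_mul]
  simpa using (isHomogeneous_C (Fin d) (c j)).mul (isHomogeneous_X k j)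

theorem reg_X : Reg (X : Fin d → MvPolynomial (Fin d) k) := by
  intro J i hi s hs
  rw [mem_ideal_span_X_image] at hs ⊢
  intro m hm
  obtain ⟨j, hj, hj0⟩ := hs (m + Finsupp.single i 1) (by
    rw [support_mul_X]; simpa using hm)
  refine ⟨j, hj, ?_⟩
  have : j ≠ i := by rintro rfl; exact hi hj
  simpa [Finsupp.single_apply, this.symm] using hj0

theorem mem_span_matAct (M : Matrix (Fin d) (Fin d) k) (hM : IsUnit M.det) (J : Set (Fin d))
    (s : MvPolynomial (Fin d) k) :
    s ∈ Ideal.span ((fun i => matAct k d M (X i)) '' J) ↔ matAct k d M⁻¹ s ∈ Ideal.span (X '' J) := by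
  have h1 : ∀ s, matAct k d M (matAct k d M⁻¹ s) = s := fun s => by
    rw [← matAct_mul, mul_nonsing_inv _ hM, matAct_one]
  have h2 : ∀ s, matAct k d M⁻¹ (matAct k d M s) = s := fun s => by
    rw [← matAct_mul, nonsing_inv_mul _ hM, matAct_one]
  constructor
  · intro h
    have := Ideal.mem_map_of_mem (matAct k d M⁻¹) h
    rw [Ideal.map_span, Set.image_image] at this
    simpa [h2] using this
  · intro h
    have := Ideal.mem_map_of_mem (matAct k d M) h
    rw [Ideal.map_span, Set.image_image] at this
    simpa [h1] using this

theorem reg_lin (M : Matrix (Fin d) (Fin d) k) (hM : IsUnit M.det) :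
    Reg fun i => lin fun j => M j i := by
  have h2 : ∀ s, matAct k d M⁻¹ (matAct k d M s) = s := fun s => by
    rw [← matAct_mul, nonsing_inv_mul _ hM, matAct_one]
  intro J i hi s hs
  simp only [← matAct_X] at hs ⊢
  rw [mem_span_matAct M hM] at hs ⊢
  rw [map_mul, h2] at hs
  exact reg_X J i hi _ hs

theorem span_lin (M : Matrix (Fin d) (Fin d) k) (hM : IsUnit M.det) :
    Ideal.span (Set.range fun i => lin fun j => M j i) = Ideal.span (Set.range X) := by
  apply le_antisymm
  · rw [Ideal.span_le]
    rintro _ ⟨i, rfl⟩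
    exact lin_mem _
  · rw [Ideal.span_le]
    rintro _ ⟨i, rfl⟩
    have := mem_span_matAct M hM Set.univ (X i)
    simp only [← matAct_X]
    rw [Set.image_univ, Set.image_univ] at this
    rw [SetLike.mem_coe, this, matAct_X]
    exact lin_mem _

theorem one_notMem : (1 : MvPolynomial (Fin d) k) ∉ Ideal.span (Set.range X) := by
  rw [← Set.image_univ, mem_ideal_span_X_image]
  intro h
  obtain ⟨i, _, hi⟩ := h 0 (by simp)
  exact hi rfl

variable (G : Subgroup (Matrix.SpecialLinearGroup (Fin d) k))

variable {G} in
/-- the matrix of a group element -/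
def gm (g : G) : Matrix (Fin d) (Fin d) k :=
  ((g : Matrix.SpecialLinearGroup (Fin d) k) : Matrix (Fin d) (Fin d) k)

variable {G} in
theorem gm_mul (g h : G) : gm (g * h) = gm g * gm h := by
  simp [gm]

variable {G} in
theorem gm_one : gm (1 : G) = 1 := by
  simp [gm]

variable {G} in
theorem gm_det (g : G) : (gm g).det = 1 := by
  simp [gm]

/-- the matrix with columns `γ_i L_i` -/
def cmat {G : Subgroup (Matrix.SpecialLinearGroup (Fin d) k)} (L : Fin d → Fin d → k) (γ : Fin d → G) :
    Matrix (Fin d) (Fin d) k :=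
  Matrix.of fun j i => (gm (γ i) *ᵥ L i) j

theorem exists_L [Infinite k] [Fintype G] : ∃ L : Fin d → Fin d → k, ∀ γ : Fin d → G, (cmat L γ).det ≠ 0 := by
  classical
  let P : (Fin d → G) → MvPolynomial (Fin d × Fin d) k := fun γ =>
    (Matrix.of fun j i => ∑ l, C (gm (γ i) j l) * X (i, l) : Matrix (Fin d) (Fin d) (MvPolynomial (Fin d × Fin d) k)).det
  have hP : ∀ γ L, eval (fun z : Fin d × Fin d => L z.1 z.2) (P γ) = (cmat L γ).det := by
    intro γ L
    simp only [P]
    rw [RingHom.map_det]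
    congr 1
    ext j i
    simp [cmat, mulVec, dotProduct]
  have hne : ∀ γ, P γ ≠ 0 := by
    intro γ h0
    have h1 := hP γ (fun i => gm (γ i)⁻¹ *ᵥ (Pi.single i 1))
    rw [h0, map_zero] at h1
    have : cmat (fun i => gm (γ i)⁻¹ *ᵥ (Pi.single i 1)) γ = 1 := by
      ext j i
      have h2 : gm (γ i) * gm (γ i)⁻¹ = 1 := by
        rw [← gm_mul, mul_inv_cancel, gm_one]
      simp only [cmat, of_apply, mulVec_mulVec]
      rw [h2, one_mulVec]
      simp [Matrix.one_apply, Pi.single_apply]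
    rw [this, det_one] at h1
    exact zero_ne_one h1
  have hprod : ∏ γ, P γ ≠ 0 := Finset.prod_ne_zero_iff.2 fun γ _ => hne γ
  by_contra! hcon
  apply hprod
  apply MvPolynomial.funext
  intro x
  obtain ⟨γ, hγ⟩ := hcon fun i j => x (i, j)
  rw [map_prod, map_zero]
  apply Finset.prod_eq_zero (Finset.mem_univ γ)
  rw [← hγ, ← hP]
end PartB2
end H16

namespace H16
section PartB3
variable {k d}
variable {G : Subgroup (Matrix.SpecialLinearGroup (Fin d) k)}

/-- the orbit of linear forms -/
def vf (L : Fin d → Fin d → k) (i : Fin d) (g : G) : MvPolynomial (Fin d) k := lin (gm g *ᵥ L i)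

theorem vf_eq (L : Fin d → Fin d → k) (γ : Fin d → G) (i : Fin d) :
    vf L i (γ i) = lin fun j => cmat L γ j i := rfl

theorem matAct_vf (L : Fin d → Fin d → k) (i : Fin d) (g h : G) :
    matAct k d (gm g) (vf L i h) = vf L i (g * h) := by
  rw [vf, matAct_lin, mulVec_mulVec, ← gm_mul, vf]

variable [Fintype G] [DecidableEq G]

/-- the parameters -/
def ff (G : Subgroup (Matrix.SpecialLinearGroup (Fin d) k)) [Fintype G] (L : Fin d → Fin d → k) (i : Fin d) : MvPolynomial (Fin d) k := ∏ g : G, vf L i g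

/-- the socle element -/
def ee (L : Fin d → Fin d → k) (γ : Fin d → G) : MvPolynomial (Fin d) k :=
  ∏ i, ∏ g ∈ Finset.univ.erase (γ i), vf L i g

theorem matAct_ff (L : Fin d → Fin d → k) (i : Fin d) (g : G) :
    matAct k d (gm g) (ff G L i) = ff G L i := by
  rw [ff, map_prod]
  simp only [matAct_vf]
  exact Fintype.prod_equiv (Equiv.mulLeft g) _ _ fun x => rfl

theorem matAct_ee (L : Fin d → Fin d → k) (γ : Fin d → G) (g : G) :
    matAct k d (gm g) (ee L γ) = ee L (fun i => g * γ i) := by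
  rw [ee, map_prod, ee]
  refine Finset.prod_congr rfl fun i _ => ?_
  rw [map_prod]
  simp only [matAct_vf]
  exact Finset.prod_equiv (Equiv.mulLeft g) (by simp) fun x _ => rfl

theorem reg_T (L : Fin d → Fin d → k) (hL : ∀ γ : Fin d → G, (cmat L γ).det ≠ 0)
    (T : Fin d → Finset G) (hT : ∀ i, (T i).Nonempty) : Reg fun i => ∏ g ∈ T i, vf L i g := by
  refine multind (S := MvPolynomial (Fin d) k) Reg (vf L) (fun h i a b => Reg.mul) ?_ _ T hT le_rfl
  intro γ
  exact reg_lin (cmat L γ) (isUnit_iff_ne_zero.2 (hL γ))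

theorem reg_ff (L : Fin d → Fin d → k) (hL : ∀ γ : Fin d → G, (cmat L γ).det ≠ 0) : Reg (ff G L) :=
  reg_T L hL (fun _ => Finset.univ) fun _ => ⟨1, Finset.mem_univ _⟩

theorem pow_ff (L : Fin d → Fin d → k) (hL : ∀ γ : Fin d → G, (cmat L γ).det ≠ 0) :
    ∃ N, (Ideal.span (Set.range X)) ^ N ≤ Ideal.span (Set.range (ff G L)) := by
  refine multind (S := MvPolynomial (Fin d) k)
    (fun h => ∃ N, (Ideal.span (Set.range X)) ^ N ≤ Ideal.span (Set.range h)) (vf L)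
    (fun h i a b => pow_closure _) ?_ _ (fun _ => Finset.univ) (fun _ => ⟨1, Finset.mem_univ _⟩) le_rfl
  intro γ
  refine ⟨1, ?_⟩
  rw [pow_one]
  exact (span_lin (cmat L γ) (isUnit_iff_ne_zero.2 (hL γ))).ge

theorem ff_hom (L : Fin d → Fin d → k) (i : Fin d) : (ff G L i).IsHomogeneous (Fintype.card G) := by
  have := IsHomogeneous.prod (Finset.univ : Finset G) (fun g => vf L i g) (fun _ => 1) fun g _ => lin_hom _
  simpa [ff] using this

theorem vf_mul_ee (L : Fin d → Fin d → k) (γ : Fin d → G) (i : Fin d) :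
    vf L i (γ i) * ee L γ ∈ Ideal.span (Set.range (ff G L)) := by
  rw [ee, ← Finset.mul_prod_erase _ _ (Finset.mem_univ i), ← mul_assoc,
    Finset.mul_prod_erase _ _ (Finset.mem_univ (γ i))]
  exact Ideal.mul_mem_right _ _ (Ideal.subset_span ⟨i, rfl⟩)

theorem X_mul_ee (L : Fin d → Fin d → k) (hL : ∀ γ : Fin d → G, (cmat L γ).det ≠ 0) (γ : Fin d → G)
    (i : Fin d) : X i * ee L γ ∈ Ideal.span (Set.range (ff G L)) := by
  have h1 : (X i : MvPolynomial (Fin d) k) ∈ Ideal.span (Set.range fun i => lin fun j => cmat L γ j i) := by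
    rw [span_lin (cmat L γ) (isUnit_iff_ne_zero.2 (hL γ))]
    exact Ideal.subset_span ⟨i, rfl⟩
  revert h1
  generalize (X i : MvPolynomial (Fin d) k) = x
  intro h1
  induction h1 using Submodule.span_induction with
  | mem x hx =>
    obtain ⟨i, rfl⟩ := hx
    exact vf_mul_ee L γ i
  | zero => simp
  | add x y _ _ hx hy => rw [add_mul]; exact Ideal.add_mem _ hx hy
  | smul a x _ hx => rw [smul_eq_mul, mul_assoc]; exact Ideal.mul_mem_left _ _ hx

theorem ee_notMem (L : Fin d → Fin d → k) (hL : ∀ γ : Fin d → G, (cmat L γ).det ≠ 0) (γ : Fin d → G) :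
    ee L γ ∉ Ideal.span (Set.range (ff G L)) := by
  have key : ∀ U : Finset (Fin d), (∏ i ∈ U, ∏ g ∈ Finset.univ.erase (γ i), vf L i g) ∉
      Ideal.span (Set.range fun i => ∏ g ∈ (if i ∈ U then Finset.univ else {γ i}), vf L i g) := by
    intro U
    induction U using Finset.induction_on with
    | empty =>
      simp only [Finset.prod_empty, Finset.notMem_empty, if_false, Finset.prod_singleton]
      intro h
      have h2 := span_lin (cmat L γ) (isUnit_iff_ne_zero.2 (hL γ))
      exact one_notMem (h2 ▸ h)
    | insert i U hi ih =>
      intro h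
      apply ih
      have e1 : (fun j => ∏ g ∈ (if j ∈ insert i U then Finset.univ else {γ j}), vf L j g) =
        Function.update (fun j => ∏ g ∈ (if j ∈ U then Finset.univ else {γ j}), vf L j g) i
          (vf L i (γ i) * ∏ g ∈ Finset.univ.erase (γ i), vf L i g) := by
        funext j
        by_cases hj : j = i
        · subst hj
          simp [Finset.mul_prod_erase]
        · simp [hj]
      have e2 : (fun j => ∏ g ∈ (if j ∈ U then Finset.univ else {γ j}), vf L j g) =
        Function.update (fun j => ∏ g ∈ (if j ∈ U then Finset.univ else {γ j}), vf L j g) i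
          (vf L i (γ i)) := by
        symm
        rw [Function.update_eq_self_iff]
        simp [hi]
      have hreg : Reg (fun j => ∏ g ∈ (if j ∈ insert i U then Finset.univ else {γ j}), vf L j g) := by
        refine reg_T L hL (fun j => if j ∈ insert i U then Finset.univ else {γ j}) fun j => ?_
        by_cases hj : j ∈ insert i U
        · rw [if_pos hj]; exact ⟨1, Finset.mem_univ _⟩
        · rw [if_neg hj]; exact Finset.singleton_nonempty _
      rw [e1, Finset.prod_insert hi] at h
      rw [e1] at hreg
      rw [e2]
      revert h hreg
      generalize (fun j => ∏ g ∈ (if j ∈ U then Finset.univ else {γ j}), vf L j g) = H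
      generalize (∏ g ∈ Finset.univ.erase (γ i), vf L i g) = b
      generalize (∏ i ∈ U, ∏ g ∈ Finset.univ.erase (γ i), vf L i g) = u
      intro h hreg
      exact Reg.colon hreg u (by rw [mul_comm u b]; exact h)
  have := key Finset.univ
  simpa [ee, ff] using! this

theorem lin_mulVec (M : Matrix (Fin d) (Fin d) k) (c : Fin d → k) :
    lin (M *ᵥ c) = ∑ j, c j • lin fun l => M l j := by
  rw [← matAct_lin, lin, map_sum]
  exact Finset.sum_congr rfl fun i _ => by rw [map_smul, matAct_X]

theorem lin_smul (a : k) (c : Fin d → k) : lin (a • c) = a • lin c := by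
  simp [lin, Finset.smul_sum, smul_smul]

theorem cramer_step (L : Fin d → Fin d → k) (γ : Fin d → G) (i : Fin d) (g' : G) :
    (cmat L γ).det • ee L γ - (cmat L (Function.update γ i g')).det • ee L (Function.update γ i g') ∈
      Ideal.span (Set.range (ff G L)) := by
  by_cases hg : g' = γ i
  · rw [hg, Function.update_eq_self, sub_self]; exact Ideal.zero_mem _
  set c : MvPolynomial (Fin d) k := (∏ j ∈ Finset.univ.erase i, ∏ g ∈ Finset.univ.erase (γ j), vf L j g) *
    ∏ g ∈ (Finset.univ.erase (γ i)).erase g', vf L i g with hc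
  have h1 : ee L γ = c * vf L i g' := by
    rw [ee, ← Finset.prod_erase_mul Finset.univ (fun j => ∏ g ∈ Finset.univ.erase (γ j), vf L j g) (Finset.mem_univ i),
      hc, mul_assoc, Finset.prod_erase_mul (Finset.univ.erase (γ i)) (fun g => vf L i g)
        (Finset.mem_erase.2 ⟨hg, Finset.mem_univ _⟩)]
  have h2 : ee L (Function.update γ i g') = c * vf L i (γ i) := by
    rw [ee, ← Finset.prod_erase_mul Finset.univ
        (fun j => ∏ g ∈ Finset.univ.erase (Function.update γ i g' j), vf L j g) (Finset.mem_univ i),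
      hc, mul_assoc, Finset.erase_right_comm,
      Finset.prod_erase_mul (Finset.univ.erase g') (fun g => vf L i g)
        (Finset.mem_erase.2 ⟨Ne.symm hg, Finset.mem_univ _⟩)]
    congr 1
    · refine Finset.prod_congr rfl fun j hj => ?_
      rw [Function.update_of_ne (Finset.ne_of_mem_erase hj)]
    · simp
  have h3 : ∀ j ≠ i, c * vf L j (γ j) ∈ Ideal.span (Set.range (ff G L)) := by
    intro j hj
    have : c * vf L j (γ j) = ff G L j * ((∏ j ∈ (Finset.univ.erase i).erase j, ∏ g ∈ Finset.univ.erase (γ j), vf L j g) *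
    ∏ g ∈ (Finset.univ.erase (γ i)).erase g', vf L i g) := by
      rw [hc, ff, ← Finset.mul_prod_erase (Finset.univ.erase i) _ (by simp [hj] : j ∈ Finset.univ.erase i),
        ← Finset.mul_prod_erase Finset.univ (fun g => vf L j g) (Finset.mem_univ (γ j))]
      ring
    rw [this]
    exact Ideal.mul_mem_right _ _ (Ideal.subset_span ⟨j, rfl⟩)
  have h4 : (cmat L γ).det • vf L i g' = ∑ j, (cramer (cmat L γ) (gm g' *ᵥ L i)) j • vf L j (γ j) := by
    rw [vf, ← lin_smul, ← mulVec_cramer, lin_mulVec]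
    rfl
  have h5 : (cramer (cmat L γ) (gm g' *ᵥ L i)) i = (cmat L (Function.update γ i g')).det := by
    rw [cramer_apply]
    congr 1
    ext a b
    by_cases hb : b = i
    · subst hb; simp [cmat]
    · simp [cmat, hb]
  rw [h1, h2, ← mul_smul_comm, ← mul_smul_comm, ← mul_sub, h4, ← Finset.add_sum_erase _ _ (Finset.mem_univ i), h5,
    add_sub_cancel_left, Finset.mul_sum]
  refine Ideal.sum_mem _ fun j hj => ?_
  rw [mul_smul_comm, smul_eq_C_mul]
  exact Ideal.mul_mem_left _ _ (h3 j (Finset.ne_of_mem_erase hj))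

theorem ee_congr (L : Fin d → Fin d → k) (γ γ' : Fin d → G) :
    (cmat L γ).det • ee L γ - (cmat L γ').det • ee L γ' ∈ Ideal.span (Set.range (ff G L)) := by
  have key : ∀ U : Finset (Fin d), (cmat L γ).det • ee L γ - (cmat L (fun i => if i ∈ U then γ' i else γ i)).det •
      ee L (fun i => if i ∈ U then γ' i else γ i) ∈ Ideal.span (Set.range (ff G L)) := by
    intro U
    induction U using Finset.induction_on with
    | empty => simp
    | insert i U hi ih =>
      have := Ideal.add_mem _ ih (cramer_step L (fun i => if i ∈ U then γ' i else γ i) i (γ' i))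
      rw [sub_add_sub_cancel] at this
      have e1 : (fun j => if j ∈ insert i U then γ' j else γ j) =
          Function.update (fun i => if i ∈ U then γ' i else γ i) i (γ' i) := by
        funext j
        by_cases hj : j = i
        · subst hj; simp
        · simp [hj]
      rw [e1]
      exact this
  simpa using key Finset.univ

theorem ee_inv (L : Fin d → Fin d → k) (hL : ∀ γ : Fin d → G, (cmat L γ).det ≠ 0) (γ : Fin d → G) (g : G) :
    matAct k d (gm g) (ee L γ) - ee L γ ∈ Ideal.span (Set.range (ff G L)) := by
  rw [matAct_ee]
  have h1 := ee_congr L (fun i => g * γ i) γ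
  have h2 : (cmat L (fun i => g * γ i)).det = (cmat L γ).det := by
    have : cmat L (fun i => g * γ i) = gm g * cmat L γ := by
      ext a b
      simp only [cmat, of_apply, gm_mul, ← mulVec_mulVec]
      rfl
    rw [this, det_mul, gm_det, one_mul]
  rw [h2, ← smul_sub, smul_eq_C_mul] at h1
  have h3 := Ideal.mul_mem_left _ (C (cmat L γ).det⁻¹) h1
  rwa [← mul_assoc, ← C_mul, inv_mul_cancel₀ (hL γ), C_1, one_mul] at h3
end PartB3
end H16

namespace H16
section PartC
variable {k d}

theorem hcomp_mul {f : MvPolynomial (Fin d) k} {n : ℕ} (hf : f.IsHomogeneous n) (D : ℕ)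
    (u : MvPolynomial (Fin d) k) : homogeneousComponent D (f * u) =
      if n ≤ D then f * homogeneousComponent (D - n) u else 0 := by
  induction u using MvPolynomial.induction_on' with
  | monomial m a =>
    have h2 : (monomial m a).IsHomogeneous m.degree := isHomogeneous_monomial a rfl
    have h1 : (f * monomial m a).IsHomogeneous (n + m.degree) := hf.mul h2
    rw [homogeneousComponent_of_mem h1, homogeneousComponent_of_mem h2]
    by_cases h : n ≤ D
    · by_cases h' : D = n + m.degree
      · rw [if_pos h', if_pos h, if_pos (by omega)]
      · rw [if_neg h', if_pos h, if_neg (by omega), mul_zero]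
    · rw [if_neg (by omega), if_neg h]
  | add p q ihp ihq =>
    rw [mul_add, map_add, ihp, ihq, map_add]
    split_ifs
    · rw [mul_add]
    · rw [add_zero]

theorem exists_w (f : Fin d → MvPolynomial (Fin d) k) (N : ℕ)
    (hN : (Ideal.span (Set.range X)) ^ N ≤ Ideal.span (Set.range f)) :
    ∃ (ι : Type) (_ : Fintype ι) (w : ι → (Fin d →₀ ℕ)),
      (∀ s : MvPolynomial (Fin d) k, ∃ c : ι → k,
        s - ∑ b, C (c b) * monomial (w b) 1 ∈ Ideal.span (Set.range f)) ∧
      (∀ c : ι → k, ∑ b, C (c b) * monomial (w b) 1 ∈ Ideal.span (Set.range f) → ∀ b, c b = 0) := by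
  set I := Ideal.span (Set.range f) with hI
  let v : {m : Fin d →₀ ℕ // m.degree < N} → (MvPolynomial (Fin d) k ⧸ I) :=
    fun m => Ideal.Quotient.mkₐ k I (monomial m.1 1)
  obtain ⟨κ, a, ha, hsp, hli⟩ := exists_linearIndependent' k v
  have : Finite {m : Fin d →₀ ℕ // m.degree < N} := Finsupp.finite_of_degree_lt N
  have : Finite κ := Finite.of_injective a ha
  have := Fintype.ofFinite κ
  have hmk : ∀ c : κ → k, Ideal.Quotient.mkₐ k I (∑ b, C (c b) * monomial (a b).1 1) = ∑ b, c b • (v ∘ a) b := by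
    intro c
    rw [map_sum]
    refine Finset.sum_congr rfl fun b _ => ?_
    rw [← smul_eq_C_mul, map_smul]
    rfl
  refine ⟨κ, inferInstance, fun b => (a b).1, ?_, ?_⟩
  · intro s
    have h1 : ∀ s, Ideal.Quotient.mkₐ k I s ∈ Submodule.span k (Set.range v) := by
      intro s
      rw [s.as_sum, map_sum]
      refine Submodule.sum_mem _ fun m _ => ?_
      have : monomial m (coeff m s) = coeff m s • monomial m (1 : k) := by
        rw [smul_monomial, smul_eq_mul, mul_one]
      rw [this, map_smul]
      refine Submodule.smul_mem _ _ ?_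
      by_cases hm : m.degree < N
      · exact Submodule.subset_span ⟨⟨m, hm⟩, rfl⟩
      · have : Ideal.Quotient.mkₐ k I (monomial m 1) = 0 := by
          rw [Ideal.Quotient.mkₐ_eq_mk, Ideal.Quotient.eq_zero_iff_mem]
          exact hN ((monomial_mem_pow_idealOfVars_iff N m one_ne_zero).2 (not_lt.1 hm))
        rw [this]; exact Submodule.zero_mem _
    have h2 := h1 s
    rw [← hsp, Submodule.mem_span_range_iff_exists_fun] at h2
    obtain ⟨c, hc⟩ := h2
    refine ⟨c, ?_⟩
    rw [← Ideal.Quotient.eq_zero_iff_mem, ← Ideal.Quotient.mkₐ_eq_mk k, map_sub, hmk, hc, sub_self]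
  · intro c hc b
    rw [← Ideal.Quotient.eq_zero_iff_mem, ← Ideal.Quotient.mkₐ_eq_mk k, hmk] at hc
    exact Fintype.linearIndependent_iff.1 hli c hc b

theorem w_span (f : Fin d → MvPolynomial (Fin d) k) (n : ℕ) (hn : 0 < n) (hf : ∀ i, (f i).IsHomogeneous n)
    {ι : Type} [Fintype ι] (w : ι → (Fin d →₀ ℕ))
    (hw : ∀ s : MvPolynomial (Fin d) k, ∃ c : ι → k,
        s - ∑ b, C (c b) * monomial (w b) 1 ∈ Ideal.span (Set.range f)) (s : MvPolynomial (Fin d) k) :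
    ∃ p : ι → MvPolynomial (Fin d) k, s = ∑ b, aeval f (p b) * monomial (w b) 1 := by
  classical
  let P : MvPolynomial (Fin d) k → Prop := fun s =>
    ∃ p : ι → MvPolynomial (Fin d) k, s = ∑ b, aeval f (p b) * monomial (w b) 1
  have P0 : P 0 := ⟨fun _ => 0, by simp⟩
  have Padd : ∀ s t, P s → P t → P (s + t) := by
    rintro _ _ ⟨p, rfl⟩ ⟨q, rfl⟩
    exact ⟨fun b => p b + q b, by simp [add_mul, Finset.sum_add_distrib]⟩
  have Psum : ∀ {J : Type} (t : Finset J) (u : J → MvPolynomial (Fin d) k), (∀ j ∈ t, P (u j)) → P (∑ j ∈ t, u j) :=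
    fun t u h => Finset.sum_induction u P Padd P0 h
  have Pmul : ∀ i s, P s → P (f i * s) := by
    rintro i _ ⟨p, rfl⟩
    exact ⟨fun b => X i * p b, by simp [Finset.mul_sum, mul_assoc]⟩
  have Pw : ∀ b c, P (C c * monomial (w b) 1) := by
    intro b c
    refine ⟨fun b' => if b' = b then C c else 0, ?_⟩
    rw [Finset.sum_eq_single b]
    · simp
    · intro b' _ h; simp [h]
    · simp
  have key : ∀ D, ∀ s : MvPolynomial (Fin d) k, s.IsHomogeneous D → P s := by
    intro D
    induction D using Nat.strong_induction_on with
    | _ D ih =>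
    intro s hs
    obtain ⟨c, hc⟩ := hw s
    obtain ⟨u, hu⟩ := (Submodule.mem_span_range_iff_exists_fun _).1 hc
    have h1 : s = ∑ i, homogeneousComponent D (f i * u i) + ∑ b, homogeneousComponent D (C (c b) * monomial (w b) 1) := by
      rw [← map_sum, ← map_sum, ← map_add, ← homogeneousComponent_eq_self hs]
      congr 1
      rw [← sub_eq_iff_eq_add, ← hu]
      exact Finset.sum_congr rfl fun i _ => mul_comm _ _
    rw [h1]
    refine Padd _ _ (Psum _ _ fun i _ => ?_) (Psum _ _ fun b _ => ?_)
    · rw [hcomp_mul (hf i)]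
      split_ifs with h
      · exact Pmul _ _ (ih (D - n) (by omega) _ (homogeneousComponent_isHomogeneous _ _))
      · exact P0
    · rw [homogeneousComponent_C_mul, homogeneousComponent_of_mem (isHomogeneous_monomial (1 : k) rfl)]
      split_ifs
      · exact Pw _ _
      · rw [mul_zero]; exact P0
  have := Psum (Finset.range (s.totalDegree + 1)) (fun i => homogeneousComponent i s) fun i _ =>
    key i _ (homogeneousComponent_isHomogeneous _ _)
  rwa [sum_homogeneousComponent] at this

theorem w_indep (f : Fin d → MvPolynomial (Fin d) k) (hreg : Reg f)
    {ι : Type} [Fintype ι] (w : ι → MvPolynomial (Fin d) k)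
    (hw : ∀ c : ι → k, ∑ b, C (c b) * w b ∈ Ideal.span (Set.range f) → ∀ b, c b = 0) :
    ∀ (c : ℕ) (J : Finset (Fin d)), Jᶜ.card = c → ∀ (n : ℕ) (p : ι → MvPolynomial (Fin d) k),
      (∀ b, ∀ m ∈ (p b).support, m.degree < n ∧ ∀ j ∈ J, m j = 0) →
      ∑ b, aeval f (p b) * w b ∈ Ideal.span (f '' (J : Set (Fin d))) → ∀ b, p b = 0 := by
  classical
  intro c
  induction c with
  | zero =>
    intro J hJ n p hp h
    have hJ : J = Finset.univ := by
      rwa [Finset.card_eq_zero, Finset.compl_eq_empty_iff] at hJ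
    subst hJ
    have h1 : ∀ b, p b = C (coeff 0 (p b)) := by
      intro b
      ext m
      rw [coeff_C]
      split_ifs with hm
      · rw [hm]
      · by_contra hne
        apply hm
        ext j
        exact ((hp b m (mem_support_iff.2 hne)).2 j (Finset.mem_univ j)).symm
    have h2 : ∀ b, coeff 0 (p b) = 0 := by
      apply hw
      rw [Finset.coe_univ, Set.image_univ] at h
      convert h using 3 with b
      conv_rhs => rw [h1 b, aeval_C]
      rfl
    intro b
    rw [h1 b, h2 b, C_0]
  | succ c ihc =>
    intro J hJ n
    induction n with
    | zero =>
      intro p hp _ b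
      rw [← support_eq_empty, Finset.eq_empty_iff_forall_notMem]
      intro m hm
      exact absurd (hp b m hm).1 (by omega)
    | succ n ihn =>
      intro p hp h
      obtain ⟨i, hi⟩ : (Jᶜ).Nonempty := by
        rw [← Finset.card_pos]; omega
      let q : ι → MvPolynomial (Fin d) k := fun b => (p b).divMonomial (Finsupp.single i 1)
      let r : ι → MvPolynomial (Fin d) k := fun b => (p b).modMonomial (Finsupp.single i 1)
      have hpq : ∀ b, p b = X i * q b + r b := fun b => (divMonomial_add_modMonomial_single (p b) i).symm
      have hsum : ∑ b, aeval f (p b) * w b = f i * ∑ b, aeval f (q b) * w b + ∑ b, aeval f (r b) * w b := by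
        rw [Finset.mul_sum, ← Finset.sum_add_distrib]
        refine Finset.sum_congr rfl fun b _ => ?_
        conv_lhs => rw [hpq b]
        rw [map_add, map_mul, aeval_X]
        ring
      have hJi : ((insert i J)ᶜ).card = c := by
        rw [Finset.compl_insert, Finset.card_erase_of_mem hi, hJ]; rfl
      have hr : ∀ b, r b = 0 := by
        refine ihc (insert i J) hJi (n + 1) r ?_ ?_
        · intro b m hm
          rw [mem_support_iff] at hm
          by_cases hle : Finsupp.single i 1 ≤ m
          · exact absurd (coeff_modMonomial_of_le _ hle) hm
          · simp only [r] at hm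
            rw [coeff_modMonomial_of_not_le _ hle] at hm
            obtain ⟨h1, h2⟩ := hp b m (mem_support_iff.2 hm)
            refine ⟨h1, fun j hj => ?_⟩
            rcases Finset.mem_insert.1 hj with rfl | hj
            · rw [Finsupp.single_le_iff] at hle; omega
            · exact h2 j hj
        · have e : ∑ b, aeval f (r b) * w b = ∑ b, aeval f (p b) * w b - f i * ∑ b, aeval f (q b) * w b := by
            rw [hsum]; ring
          rw [e]
          refine Ideal.sub_mem _ (Ideal.span_mono (Set.image_mono (by simp)) h) (Ideal.mul_mem_right _ _ (Ideal.subset_span ⟨i, by simp, rfl⟩))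
      have hq : ∀ b, q b = 0 := by
        refine ihn q ?_ ?_
        · intro b m hm
          rw [mem_support_iff] at hm
          simp only [q] at hm
          rw [coeff_divMonomial] at hm
          obtain ⟨h1, h2⟩ := hp b _ (mem_support_iff.2 hm)
          refine ⟨?_, fun j hj => ?_⟩
          · simp only [map_add, Finsupp.degree_single] at h1; omega
          · have := h2 j hj
            simp only [Finsupp.add_apply] at this
            omega
        · apply hreg J i (by simpa using hi)
          simp only [hr, map_zero, zero_mul, Finset.sum_const_zero, add_zero] at hsum
          rw [mul_comm, ← hsum]
          exact h
      intro b
      rw [hpq b, hq b, hr b, mul_zero, add_zero]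

theorem w_indep' (f : Fin d → MvPolynomial (Fin d) k) (hreg : Reg f)
    {ι : Type} [Fintype ι] (w : ι → MvPolynomial (Fin d) k)
    (hw : ∀ c : ι → k, ∑ b, C (c b) * w b ∈ Ideal.span (Set.range f) → ∀ b, c b = 0)
    (p : ι → MvPolynomial (Fin d) k) (h : ∑ b, aeval f (p b) * w b = 0) (b : ι) : p b = 0 := by
  refine w_indep f hreg w hw _ ∅ rfl (Finset.univ.sup (fun b => (p b).totalDegree) + 1) p ?_ (h ▸ Ideal.zero_mem _) b
  intro b m hm
  refine ⟨Nat.lt_succ_of_le ((le_totalDegree hm).trans (Finset.le_sup (f := fun b => (p b).totalDegree) (Finset.mem_univ b))), by simp⟩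
end PartC
end H16

namespace H16
section PartD0

theorem abstract_dual {A R S : Type} [CommRing A] [IsDomain A] [CommRing R] [CommRing S] [IsDomain S]
    [Algebra A R] [Algebra R S] [Algebra A S] [IsScalarTower A R S] 
    (ρ : S →ₗ[R] R) (hρ : ∀ r, ρ (algebraMap R S r) = r) (σ : S →ₗ[A] A)
    (hnd : ∀ s, (∀ x, σ (s * x) = 0) → s = 0)
    (hσ : ∀ φ : S →ₗ[A] A, ∃ s, ∀ x, φ x = σ (s * x))
    (hσρ : ∀ x, σ (algebraMap R S (ρ x)) = σ x) :
    ∃ τ : R →ₗ[A] A, (∀ φ : R →ₗ[A] A, ∃ s, ∀ r, φ r = τ (s * r)) ∧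
      (∀ s, (∀ r, τ (s * r) = 0) → s = 0) ∧ Nonempty ((S →ₗ[R] R) ≃ₗ[R] S) := by
  let τ : R →ₗ[A] A := σ ∘ₗ (Algebra.linearMap R S).restrictScalars A
  have hτd : ∀ r, τ r = σ (algebraMap R S r) := fun r => rfl
  have hρm : ∀ r x, ρ (algebraMap R S r * x) = r * ρ x := fun r x => by
    rw [← Algebra.smul_def, map_smul, smul_eq_mul]
  have hτ' : ∀ s, (∀ r, τ (s * r) = 0) → s = 0 := by
    intro s hs
    have : algebraMap R S s = 0 := hnd _ fun x => by
      rw [← hσρ, hρm, ← hτd, hs]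
    rw [← hρ s, this, map_zero]
  refine ⟨τ, ?_, hτ', ⟨?_⟩⟩
  · intro φ
    obtain ⟨s, hs⟩ := hσ (φ ∘ₗ ρ.restrictScalars A)
    refine ⟨ρ s, fun r => ?_⟩
    have := hs (algebraMap R S r)
    simp only [LinearMap.comp_apply, LinearMap.restrictScalars_apply, hρ] at this
    rw [this, ← hσρ, mul_comm, hρm, hτd, mul_comm]
  · let F : S →ₗ[R] (S →ₗ[R] R) :=
      { toFun := fun s => ρ ∘ₗ LinearMap.mulLeft R s
        map_add' := fun s t => by ext x; simp [add_mul]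
        map_smul' := fun r s => by ext x; simp }
    have hF : ∀ s x, F s x = ρ (s * x) := fun s x => rfl
    refine (LinearEquiv.ofBijective F ⟨?_, ?_⟩).symm
    · rw [injective_iff_map_eq_zero]
      intro s hs
      apply hnd
      intro x
      rw [← hσρ, ← hF, hs, LinearMap.zero_apply, map_zero, map_zero]
    · intro φ
      obtain ⟨s, hs⟩ := hσ (τ ∘ₗ φ.restrictScalars A)
      refine ⟨s, ?_⟩
      ext x
      rw [hF, ← sub_eq_zero]
      apply hτ'
      intro r
      have h1 := hs (r • x)
      simp only [LinearMap.comp_apply, LinearMap.restrictScalars_apply, map_smul, smul_eq_mul] at h1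
      rw [sub_mul, map_sub, mul_comm _ r, mul_comm _ r, h1, ← hρm, hτd, hσρ, Algebra.smul_def,
        mul_left_comm, sub_self]
end PartD0

section PartD
variable {k d}

theorem sub_C_mem (s : MvPolynomial (Fin d) k) :
    s - C (constantCoeff s) ∈ Ideal.span (Set.range (X : Fin d → MvPolynomial (Fin d) k)) := by
  have := (mem_pow_idealOfVars_iff' (σ := Fin d) (R := k) 1 (s - C (constantCoeff s))).2 (by
    intro x hx
    have : x = 0 := by rw [← Finsupp.degree_eq_zero_iff]; omega
    subst this
    simp [constantCoeff_eq])
  rwa [pow_one] at this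

theorem aeval_mem (f : Fin d → MvPolynomial (Fin d) k) (p : MvPolynomial (Fin d) k) (hp : constantCoeff p = 0) :
    aeval f p ∈ Ideal.span (Set.range f) := by
  have h := sub_C_mem p
  rw [hp, C_0, sub_zero] at h
  have h2 := Ideal.mem_map_of_mem (aeval f : MvPolynomial (Fin d) k →ₐ[k] MvPolynomial (Fin d) k) h
  rw [Ideal.map_span, ← Set.range_comp] at h2
  convert h2 using 3
  funext i
  simp

variable (G : Subgroup (Matrix.SpecialLinearGroup (Fin d) k)) [Fintype G]

/-- averaging -/
def avg (s : MvPolynomial (Fin d) k) : MvPolynomial (Fin d) k :=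
  C (Fintype.card G : k)⁻¹ * ∑ g : G, matAct k d (gm g) s

theorem matAct_C (M : Matrix (Fin d) (Fin d) k) (c : k) : matAct k d M (C c) = C c :=
  (matAct k d M).commutes c

theorem avg_mem (s : MvPolynomial (Fin d) k) : avg G s ∈ invRSL k d G := by
  intro g hg
  change matAct k d (gm (⟨g, hg⟩ : G)) _ = _
  rw [avg, map_mul, matAct_C, map_sum]
  congr 1
  simp only [← matAct_mul, ← gm_mul]
  exact Fintype.sum_equiv (Equiv.mulLeft (⟨g, hg⟩ : G)) _ _ fun x => rfl

variable {G} in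
theorem inv_eq (r : invRSL k d G) (g : G) : matAct k d (gm g) r = r := r.2 g.1 g.2

/-- the Reynolds operator -/
def rey : MvPolynomial (Fin d) k →ₗ[invRSL k d G] invRSL k d G where
  toFun s := ⟨avg G s, avg_mem G s⟩
  map_add' s t := by
    ext1
    simp [avg, Finset.sum_add_distrib, mul_add]
  map_smul' r s := by
    ext1
    change avg G ((r : MvPolynomial (Fin d) k) * s) = (r : MvPolynomial (Fin d) k) * avg G s
    simp only [avg, map_mul, inv_eq, ← Finset.mul_sum]
    ring

theorem rey_coe (s : MvPolynomial (Fin d) k) : (rey G s : MvPolynomial (Fin d) k) = avg G s := rfl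

theorem rey_alg [CharZero k] (r : invRSL k d G) : rey G (algebraMap _ _ r) = r := by
  ext1
  rw [rey_coe, avg]
  change _ * ∑ g : G, matAct k d (gm g) (r : MvPolynomial (Fin d) k) = _
  simp only [inv_eq, Finset.sum_const, Finset.card_univ, nsmul_eq_mul, ← mul_assoc]
  have : (C (Fintype.card G : k)⁻¹ * ((Fintype.card G : ℕ) : MvPolynomial (Fin d) k)) = 1 := by
    rw [← map_natCast (C : k →+* MvPolynomial (Fin d) k), ← C_mul, inv_mul_cancel₀, C_1]
    exact Nat.cast_ne_zero.2 Fintype.card_ne_zero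
  rw [this, one_mul]

theorem card_avg [CharZero k] (s : MvPolynomial (Fin d) k) : Fintype.card G • avg G s = ∑ g : G, matAct k d (gm g) s := by
  rw [avg, nsmul_eq_mul, ← mul_assoc]
  have : (((Fintype.card G : ℕ) : MvPolynomial (Fin d) k) * C (Fintype.card G : k)⁻¹) = 1 := by
    rw [← map_natCast (C : k →+* MvPolynomial (Fin d) k), ← C_mul, mul_inv_cancel₀, C_1]
    exact Nat.cast_ne_zero.2 Fintype.card_ne_zero
  rw [this, one_mul]
end PartD

/-- copy of the polynomial ring, for the parameters -/
def PA : Type := MvPolynomial (Fin d) k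
instance : CommRing (PA k d) := inferInstanceAs (CommRing (MvPolynomial (Fin d) k))
instance : IsDomain (PA k d) := inferInstanceAs (IsDomain (MvPolynomial (Fin d) k))
instance : UniqueFactorizationMonoid (PA k d) := inferInstanceAs (UniqueFactorizationMonoid (MvPolynomial (Fin d) k))
instance : IsNoetherianRing (PA k d) := inferInstanceAs (IsNoetherianRing (MvPolynomial (Fin d) k))
instance [CharZero k] : CharZero (PA k d) := inferInstanceAs (CharZero (MvPolynomial (Fin d) k))
/-- identification -/
def PA.mk : MvPolynomial (Fin d) k ≃+* PA k d := RingEquiv.refl _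

end H16

namespace H16
section PartF
variable {k d}

/-- constant coefficient -/
def cc : PA k d →+* k := (constantCoeff (R := k) (σ := Fin d)).comp (PA.mk k d).symm.toRingHom

theorem cc_mk (p : MvPolynomial (Fin d) k) : cc (PA.mk k d p) = constantCoeff p := rfl

theorem sigma_inv (G : Subgroup (Matrix.SpecialLinearGroup (Fin d) k)) (f : Fin d → MvPolynomial (Fin d) k)
    [Algebra (PA k d) (MvPolynomial (Fin d) k)]
    (halg : ∀ p, algebraMap (PA k d) (MvPolynomial (Fin d) k) (PA.mk k d p) = aeval f p)
    {ι : Type} [Fintype ι] (b : Module.Basis ι (PA k d) (MvPolynomial (Fin d) k))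
    (σ : MvPolynomial (Fin d) k →ₗ[PA k d] PA k d)
    (hnd : ∀ s, (∀ x, σ (s * x) = 0) → s = 0)
    (hσ : ∀ φ : MvPolynomial (Fin d) k →ₗ[PA k d] PA k d, ∃ s, ∀ x, φ x = σ (s * x))
    (hfinv : ∀ (g : G) i, matAct k d (gm g) (f i) = f i)
    (e : MvPolynomial (Fin d) k) (he1 : ∀ i, X i * e ∈ Ideal.span (Set.range f))
    (he2 : e ∉ Ideal.span (Set.range f))
    (he3 : ∀ g : G, matAct k d (gm g) e - e ∈ Ideal.span (Set.range f))
    (g : G) (x : MvPolynomial (Fin d) k) : σ (matAct k d (gm g) x) = σ x := by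
  have halg' : ∀ p : PA k d, algebraMap (PA k d) (MvPolynomial (Fin d) k) p = aeval f ((PA.mk k d).symm p) :=
    fun p => halg ((PA.mk k d).symm p)
  have hσa : ∀ p s, σ (aeval f p * s) = PA.mk k d p * σ s := by
    intro p s
    rw [← halg, ← Algebra.smul_def, map_smul, smul_eq_mul]
  have hσC : ∀ c s, σ (C c * s) = PA.mk k d (C c) * σ s := by
    intro c s
    rw [← hσa, aeval_C]; rfl
  have hccf : ∀ s ∈ Ideal.span (Set.range f), cc (σ s) = 0 := by
    intro s hs
    obtain ⟨u, rfl⟩ := (Submodule.mem_span_range_iff_exists_fun _).1 hs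
    rw [map_sum, map_sum]
    refine Finset.sum_eq_zero fun i _ => ?_
    have := hσa (X i) (u i)
    rw [aeval_X] at this
    rw [smul_eq_mul, mul_comm, this, map_mul, cc_mk, constantCoeff_X, zero_mul]
  have hspan : ∀ s ∈ Ideal.span (Set.range (X : Fin d → MvPolynomial (Fin d) k)), s * e ∈ Ideal.span (Set.range f) := by
    intro s hs
    obtain ⟨u, rfl⟩ := (Submodule.mem_span_range_iff_exists_fun _).1 hs
    rw [Finset.sum_mul]
    refine Ideal.sum_mem _ fun i _ => ?_
    rw [smul_eq_mul, mul_assoc]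
    exact Ideal.mul_mem_left _ _ (he1 i)
  have hcce : cc (σ e) ≠ 0 := by
    intro h0
    have h1 : ∀ φ : MvPolynomial (Fin d) k →ₗ[PA k d] PA k d, cc (φ e) = 0 := by
      intro φ
      obtain ⟨s, hs⟩ := hσ φ
      have e1 : s * e = (s - C (constantCoeff s)) * e + C (constantCoeff s) * e := by ring
      rw [hs, e1, map_add, map_add, hccf _ (hspan _ (sub_C_mem s)), hσC, map_mul, h0, mul_zero, add_zero]
    apply he2
    rw [← b.sum_repr e]
    refine Ideal.sum_mem _ fun i _ => ?_
    rw [Algebra.smul_def, halg']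
    exact Ideal.mul_mem_right _ _ (aeval_mem f _ (h1 (b.coord i)))
  -- A-linear action
  have hact : ∀ (g : G) (p : MvPolynomial (Fin d) k), matAct k d (gm g) (aeval f p) = aeval f p := by
    intro g p
    have : (matAct k d (gm g)).comp (aeval f : MvPolynomial (Fin d) k →ₐ[k] MvPolynomial (Fin d) k) = aeval f := by
      apply MvPolynomial.algHom_ext
      intro i
      simp [hfinv]
    exact DFunLike.congr_fun this p
  let act : G → MvPolynomial (Fin d) k →ₗ[PA k d] MvPolynomial (Fin d) k := fun g =>
    { toFun := matAct k d (gm g)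
      map_add' := fun x y => map_add _ _ _
      map_smul' := fun p x => by
        rw [Algebra.smul_def, map_mul, halg', hact, Algebra.smul_def, halg']; rfl }
  have hu : ∀ g : G, ∃ u, ∀ x, σ (matAct k d (gm g) x) = σ (u * x) := fun g => hσ (σ ∘ₗ act g)
  have hinv : ∀ (g : G) x, matAct k d (gm g) (matAct k d (gm g⁻¹) x) = x := fun g x => by
    rw [← matAct_mul, ← gm_mul, mul_inv_cancel, gm_one, matAct_one]
  have hinv' : ∀ (g : G) x, matAct k d (gm g⁻¹) (matAct k d (gm g) x) = x := fun g x => by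
    rw [← matAct_mul, ← gm_mul, inv_mul_cancel, gm_one, matAct_one]
  obtain ⟨u, hu1⟩ := hu g
  obtain ⟨v, hv1⟩ := hu g⁻¹
  have huv : v * matAct k d (gm g) u = 1 := by
    rw [← sub_eq_zero]
    apply hnd
    intro x
    rw [sub_mul, one_mul, map_sub, mul_assoc, ← hv1, map_mul, hinv', ← hu1, hinv, sub_self]
  have hunit : IsUnit u := by
    have : IsUnit (matAct k d (gm g) u) := IsUnit.of_mul_eq_one v (by rw [mul_comm]; exact huv)
    have := this.map (matAct k d (gm g⁻¹))
    rwa [hinv'] at this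
  obtain ⟨c, hc, rfl⟩ := MvPolynomial.isUnit_iff_eq_C_of_isReduced.1 hunit
  have h1 := hu1 e
  rw [hσC] at h1
  have h2 := hccf _ (he3 g)
  rw [map_sub, map_sub, h1, map_mul, cc_mk, constantCoeff_C, sub_eq_zero] at h2
  have : c = 1 := mul_right_cancel₀ hcce (by rw [h2, one_mul])
  rw [hu1, this, C_1, one_mul]

theorem main_data [CharZero k] (G : Subgroup (Matrix.SpecialLinearGroup (Fin d) k)) [Fintype G] :
    IsNoetherianRing (invRSL k d G) ∧ ∃ (_ : Algebra (PA k d) (invRSL k d G)),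
      Module.Projective (PA k d) (invRSL k d G) ∧
      ∃ τ : invRSL k d G →ₗ[PA k d] PA k d,
        (∀ φ : invRSL k d G →ₗ[PA k d] PA k d, ∃ s, ∀ r, φ r = τ (s * r)) ∧
      (∀ s, (∀ r, τ (s * r) = 0) → s = 0) ∧
      Nonempty ((MvPolynomial (Fin d) k →ₗ[invRSL k d G] invRSL k d G) ≃ₗ[invRSL k d G] MvPolynomial (Fin d) k) := by
  classical
  obtain ⟨L, hL⟩ := exists_L G
  let fR : Fin d → invRSL k d G := fun i => ⟨ff G L i, fun g hg => matAct_ff L i ⟨g, hg⟩⟩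
  letI iAR : Algebra (PA k d) (invRSL k d G) :=
    ((aeval fR : MvPolynomial (Fin d) k →ₐ[k] invRSL k d G).toRingHom.comp (PA.mk k d).symm.toRingHom).toAlgebra
  letI iAS : Algebra (PA k d) (MvPolynomial (Fin d) k) :=
    ((algebraMap (invRSL k d G) (MvPolynomial (Fin d) k)).comp (algebraMap (PA k d) (invRSL k d G))).toAlgebra
  haveI : IsScalarTower (PA k d) (invRSL k d G) (MvPolynomial (Fin d) k) := IsScalarTower.of_algebraMap_eq' rfl
  have halg : ∀ p, algebraMap (PA k d) (MvPolynomial (Fin d) k) (PA.mk k d p) = aeval (ff G L) p := by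
    intro p
    have : ((invRSL k d G).val).comp (aeval fR) = aeval (ff G L) := by
      apply MvPolynomial.algHom_ext
      intro i
      simp [fR]
    exact DFunLike.congr_fun this p
  obtain ⟨N, hN⟩ := pow_ff L hL
  obtain ⟨ι, _, w, hw1, hw2⟩ := exists_w (ff G L) N hN
  have hli : LinearIndependent (PA k d) (fun b => (monomial (w b) 1 : MvPolynomial (Fin d) k)) := by
    rw [Fintype.linearIndependent_iff]
    intro p hp
    refine w_indep' (ff G L) (reg_ff L hL) _ hw2 (fun b => (PA.mk k d).symm (p b)) ?_
    rw [← hp]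
    refine Finset.sum_congr rfl fun b _ => ?_
    rw [Algebra.smul_def, ← halg]; rfl
  have hsp : ⊤ ≤ Submodule.span (PA k d) (Set.range fun b => (monomial (w b) 1 : MvPolynomial (Fin d) k)) := by
    intro s _
    obtain ⟨p, rfl⟩ := w_span (ff G L) (Fintype.card G) Fintype.card_pos (ff_hom L) w hw1 s
    refine Submodule.sum_mem _ fun b _ => ?_
    rw [← halg, ← Algebra.smul_def]
    exact Submodule.smul_mem _ _ (Submodule.subset_span ⟨b, rfl⟩)
  let bas := Module.Basis.mk hli hsp
  haveI : Module.Free (PA k d) (MvPolynomial (Fin d) k) := Module.Free.of_basis bas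
  haveI : Module.Finite (PA k d) (MvPolynomial (Fin d) k) := Module.Finite.of_basis bas
  haveI : FaithfulSMul (PA k d) (MvPolynomial (Fin d) k) := inferInstance
  obtain ⟨σ, hσ0, hσ⟩ := exists_dual (A := PA k d) (S := MvPolynomial (Fin d) k)
  have hnd : ∀ s, (∀ x, σ (s * x) = 0) → s = 0 := by
    intro s hs
    by_contra hne
    exact hσ0 (act_inj _ hne σ hs)
  have hσinv := sigma_inv G (ff G L) halg bas σ hnd hσ (fun g i => matAct_ff L i g) (ee L fun _ => 1)
    (X_mul_ee L hL _) (ee_notMem L hL _) (ee_inv L hL _)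
  have hσρ : ∀ x, σ (algebraMap _ _ (rey G x)) = σ x := by
    intro x
    change σ (avg G x) = σ x
    have h1 : Fintype.card G • σ (avg G x) = Fintype.card G • σ x := by
      rw [← map_nsmul, card_avg, map_sum]
      simp [hσinv]
    exact smul_right_injective _ Fintype.card_ne_zero h1
  have hfin : Module.Finite (PA k d) (invRSL k d G) :=
    Module.Finite.of_surjective ((rey G).restrictScalars (PA k d)) fun r => ⟨_, rey_alg G r⟩
  refine ⟨IsNoetherianRing.of_finite (PA k d) _, iAR, ?_, ?_⟩
  · refine Module.Projective.of_split ((Algebra.linearMap (invRSL k d G) (MvPolynomial (Fin d) k)).restrictScalars (PA k d))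
      ((rey G).restrictScalars (PA k d)) ?_
    ext1 r
    exact rey_alg G r
  · exact abstract_dual (rey G) (rey_alg G) σ hnd hσ hσρ

end PartF
end H16


open CategoryTheory in
/-- **Statement 16** (step (ii) of the proof of Theorem 4.2): let `G ≤ SL_d(k)` be finite
(char `k` = 0) with `R = S^G` an isolated singularity.  If `X` is a finitely generated
maximal Cohen–Macaulay `R`-module (`Ext^i_R(X,R) = 0` for `i > 0`) with
`Ext^j_R(X, S) = 0` for `0 < j < d - 1`, then `X` is a direct summand of a finite direct
sum of copies of `S` as an `R`-module. -/
theorem stmt_16 [CharZero k] (G : Subgroup (Matrix.SpecialLinearGroup (Fin d) k))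
    [Fintype G] (hiso : IsIsolatedSing k d G)
    (X : Type) [AddCommGroup X] [Module ↥(invRSL k d G) X]
    [Module.Finite ↥(invRSL k d G) X]
    (hCM : ∀ i : ℕ, 0 < i →
      Subsingleton
        (((Ext ↥(invRSL k d G) (ModuleCat ↥(invRSL k d G)) i).obj
            (Opposite.op (ModuleCat.of ↥(invRSL k d G) X))).obj
          (ModuleCat.of ↥(invRSL k d G) ↥(invRSL k d G))))
    (hExtS : ∀ j : ℕ, 0 < j → j + 1 < d →
      Subsingleton
        (((Ext ↥(invRSL k d G) (ModuleCat ↥(invRSL k d G)) j).obj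
            (Opposite.op (ModuleCat.of ↥(invRSL k d G) X))).obj
          (ModuleCat.of ↥(invRSL k d G) (MvPolynomial (Fin d) k)))) :
    ∃ (n : ℕ) (ι : X →ₗ[↥(invRSL k d G)] (Fin n → MvPolynomial (Fin d) k))
      (π : (Fin n → MvPolynomial (Fin d) k) →ₗ[↥(invRSL k d G)] X),
      π.comp ι = LinearMap.id := by
  obtain ⟨hno, iAR, hproj, τ, hτ, hτ', ⟨e⟩⟩ := H16.main_data (k := k) (d := d) G
  obtain ⟨m, δ, ε, hε, h0, hδ⟩ := H16.exists_res (↥(invRSL k d G)) X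
  have hA : H16.GlDim (H16.PA k d) d := H16.GlDim.of_equiv (H16.PA.mk k d) (H16.GlDim_mvPolynomial k d)
  refine H16.abstract_main m δ ε hε h0 hδ d d hA (H16.GlDim_mvPolynomial k d) (H16.rey G) (H16.rey_alg G) τ hτ hτ' e
    (fun i φ hφ => H16.ext_vanish m δ ε hε h0 hδ _ i (hCM (i + 1) (by omega)) φ hφ)
    (fun i hi φ hφ => H16.ext_vanish m δ ε hε h0 hδ _ i (hExtS (i + 1) (by omega) (by omega)) φ hφ)
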